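/- (Inner bound of Theorem 1.) Every rate–equivocation triple in ℛ_in is achievable, i.e., ℛ_in ⊆ ℛ. -/

import Mathlib

open scoped BigOperators

noncomputable section

namespace SSW

/-- Probability that the random variable `X` takes the value `x`, under the pmf `p`. -/
def pr {Ω α : Type*} [Fintype Ω] (p : Ω → ℝ) (X : Ω → α) (x : α) : ℝ :=
  ∑ ω, @ite _ (X ω = x) (Classical.propDecidable _) (p ω) 0

/-- Probability of the event `s` under the pmf `p`. -/
def prE {Ω : Type*} [Fintype Ω] (p : Ω → ℝ) (s : Ω → Prop) : ℝ :=
  ∑ ω, @ite _ (s ω) (Classical.propDecidable _) (p ω) 0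

/-- Shannon entropy (base 2) of the random variable `X` under the pmf `p`. -/
def H {Ω α : Type*} [Fintype Ω] [Fintype α] (p : Ω → ℝ) (X : Ω → α) : ℝ :=
  ∑ x, -(pr p X x * Real.logb 2 (pr p X x))

/-- Conditional Shannon entropy `H(X|Y) = H(X,Y) - H(Y)` (base 2). -/
def Hc {Ω α β : Type*} [Fintype Ω] [Fintype α] [Fintype β]
    (p : Ω → ℝ) (X : Ω → α) (Y : Ω → β) : ℝ :=
  H p (fun ω => (X ω, Y ω)) - H p Y

/-- Mutual information `I(X;Y) = H(X) + H(Y) - H(X,Y)` (base 2). -/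
def MI {Ω α β : Type*} [Fintype Ω] [Fintype α] [Fintype β]
    (p : Ω → ℝ) (X : Ω → α) (Y : Ω → β) : ℝ :=
  H p X + H p Y - H p (fun ω => (X ω, Y ω))

/-- Conditional mutual information `I(X;Y|Z) = H(X|Z) - H(X|Y,Z)` (base 2). -/
def cMI {Ω α β γ : Type*} [Fintype Ω] [Fintype α] [Fintype β] [Fintype γ]
    (p : Ω → ℝ) (X : Ω → α) (Y : Ω → β) (Z : Ω → γ) : ℝ :=
  Hc p X Z - Hc p X (fun ω => (Y ω, Z ω))

/-- `p` is a probability mass function on the finite type `Ω`. -/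
def IsPMF {Ω : Type*} [Fintype Ω] (p : Ω → ℝ) : Prop :=
  (∀ ω, 0 ≤ p ω) ∧ ∑ ω, p ω = 1

/-- The Markov chain `X − Y − Z`: `X` and `Z` are conditionally independent given `Y`. -/
def Markov {Ω α β γ : Type*} [Fintype Ω] (p : Ω → ℝ)
    (X : Ω → α) (Y : Ω → β) (Z : Ω → γ) : Prop :=
  ∀ x y z,
    pr p (fun ω => (X ω, Y ω, Z ω)) (x, y, z) * pr p Y y =
      pr p (fun ω => (X ω, Y ω)) (x, y) * pr p (fun ω => (Y ω, Z ω)) (y, z)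

/-- `k` is a conditional probability kernel from `α` to `β`. -/
def IsKernel {α β : Type*} [Fintype β] (k : α → β → ℝ) : Prop :=
  ∀ a, (∀ b, 0 ≤ k a b) ∧ ∑ b, k a b = 1

/-- The i.i.d. block pmf on `Fin N → S` induced by the single-letter pmf `p` on `S`. -/
def blk {S : Type*} [Fintype S] (N : ℕ) (p : S → ℝ) : (Fin N → S) → ℝ :=
  fun ω => ∏ i, p (ω i)

end SSW

open SSW

/-- The achievability of a compression–equivocation triple `(R_A, R_C, Δ)` for secure
distributed compression of the i.i.d. source `(A, C, E) ~ p` (Definition 1):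
for every `ε > 0` there is an `(M_A, M_C, N)` code (encoders `f_A`, `f_C` and decoder `g`)
with `log M_A ≤ N (R_A + ε)`, `log M_C ≤ N (R_C + ε)`,
`H(A^N | f_A(A^N), E^N) ≥ N (Δ - ε)` and error probability `< ε`. -/
def Achievable {𝒜 𝒞 ℰ : Type} [Fintype 𝒜] [Fintype 𝒞] [Fintype ℰ]
    (p : 𝒜 × 𝒞 × ℰ → ℝ) (RA RC Δ : ℝ) : Prop :=
  ∀ ε : ℝ, 0 < ε →
    ∃ (N MA MC : ℕ), 0 < N ∧ 0 < MA ∧ 0 < MC ∧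
      ∃ (fA : (Fin N → 𝒜) → Fin MA) (fC : (Fin N → 𝒞) → Fin MC)
        (g : Fin MA → Fin MC → (Fin N → 𝒜) × (Fin N → 𝒞)),
        Real.logb 2 (MA : ℝ) ≤ N * (RA + ε) ∧
        Real.logb 2 (MC : ℝ) ≤ N * (RC + ε) ∧
        Hc (blk N p) (fun ω => (fun i => (ω i).1))
            (fun ω => (fA (fun i => (ω i).1), fun i => (ω i).2.2)) ≥ N * (Δ - ε) ∧
        prE (blk N p)
            (fun ω => g (fA (fun i => (ω i).1)) (fC (fun i => (ω i).2.1)) ≠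
              ((fun i => (ω i).1), (fun i => (ω i).2.1))) < ε

/-- The set of triples `(R_A, R_C, Δ)` for which there exists `(U, V) ∈ 𝒫_in`, i.e. finite-valued
auxiliary random variables with joint distribution `p_{ACE} · p_{U|A} · p_{V|C}` satisfying
`H(C|A,V) = 0`, such that `R_C ≥ I(C;V)`, `R_A ≥ H(A|V)`,
`Δ ≤ [I(A;V|U) − I(A;E|U)]⁺`, `Δ ≤ min{R_C − H(C|A), I(A;C)}` and `Δ ≥ [H(A|E) − R_A]⁺`.
`ℛ_in` is the convex hull of this set. -/
def RinBase {𝒜 𝒞 ℰ : Type} [Fintype 𝒜] [Fintype 𝒞] [Fintype ℰ]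
    (p : 𝒜 × 𝒞 × ℰ → ℝ) : Set (ℝ × ℝ × ℝ) :=
  { r | ∃ (nU nV : ℕ) (pU : 𝒜 → Fin nU → ℝ) (pV : 𝒞 → Fin nV → ℝ)
      (q : 𝒜 × 𝒞 × ℰ × Fin nU × Fin nV → ℝ),
      IsKernel pU ∧ IsKernel pV ∧
      (∀ x, q x = p (x.1, x.2.1, x.2.2.1) * pU x.1 x.2.2.2.1 * pV x.2.1 x.2.2.2.2) ∧
      Hc q (fun x => x.2.1) (fun x => (x.1, x.2.2.2.2)) = 0 ∧
      r.2.1 ≥ MI q (fun x => x.2.1) (fun x => x.2.2.2.2) ∧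
      r.1 ≥ Hc q (fun x => x.1) (fun x => x.2.2.2.2) ∧
      r.2.2 ≤ max (cMI q (fun x => x.1) (fun x => x.2.2.2.2) (fun x => x.2.2.2.1) -
                   cMI q (fun x => x.1) (fun x => x.2.2.1) (fun x => x.2.2.2.1)) 0 ∧
      r.2.2 ≤ min (r.2.1 - Hc q (fun x => x.2.1) (fun x => x.1))
                  (MI q (fun x => x.1) (fun x => x.2.1)) ∧
      r.2.2 ≥ max (Hc q (fun x => x.1) (fun x => x.2.2.1) - r.1) 0 }

namespace SSW

section Basic

open scoped Classical

variable {Ω Ω' α β γ : Type*} [Fintype Ω] [Fintype Ω'] [Fintype α] [Fintype β] [Fintype γ]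

lemma pr_nonneg {p : Ω → ℝ} (hp : ∀ ω, 0 ≤ p ω) {α : Type*} (X : Ω → α) (x : α) :
    0 ≤ pr p X x := by
  unfold pr
  refine Finset.sum_nonneg fun ω _ => ?_
  split_ifs
  exacts [hp ω, le_rfl]

lemma prE_nonneg {p : Ω → ℝ} (hp : ∀ ω, 0 ≤ p ω) (s : Ω → Prop) : 0 ≤ prE p s := by
  unfold prE
  refine Finset.sum_nonneg fun ω _ => ?_
  split_ifs
  exacts [hp ω, le_rfl]

lemma prE_mono {p : Ω → ℝ} (hp : ∀ ω, 0 ≤ p ω) {s t : Ω → Prop}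
    (h : ∀ ω, 0 < p ω → s ω → t ω) : prE p s ≤ prE p t := by
  unfold prE
  refine Finset.sum_le_sum fun ω _ => ?_
  rcases (hp ω).lt_or_eq with h0 | h0
  · have := h ω h0
    split_ifs <;> first | exact le_rfl | exact hp ω | tauto
  · simp [← h0]

lemma prE_or_le {p : Ω → ℝ} (hp : ∀ ω, 0 ≤ p ω) (s t : Ω → Prop) :
    prE p (fun ω => s ω ∨ t ω) ≤ prE p s + prE p t := by
  unfold prE
  rw [← Finset.sum_add_distrib]
  refine Finset.sum_le_sum fun ω _ => ?_
  have := hp ω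
  by_cases h1 : s ω <;> by_cases h2 : t ω <;> simp [h1, h2, this]

lemma sum_pr_mul (p : Ω → ℝ) (X : Ω → α) (F : α → ℝ) :
    ∑ x, pr p X x * F x = ∑ ω, p ω * F (X ω) := by
  unfold pr
  simp_rw [Finset.sum_mul]
  rw [Finset.sum_comm]
  refine Finset.sum_congr rfl fun ω _ => ?_
  simp [ite_mul]

lemma sum_pr (p : Ω → ℝ) (X : Ω → α) : ∑ x, pr p X x = ∑ ω, p ω := by
  simpa using sum_pr_mul p X (fun _ => 1)

lemma sum_pr_fst (p : Ω → ℝ) (X : Ω → α) {β : Type*} (Y : Ω → β) (y : β) :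
    ∑ x, pr p (fun ω => (X ω, Y ω)) (x, y) = pr p Y y := by
  unfold pr
  rw [Finset.sum_comm]
  refine Finset.sum_congr rfl fun ω _ => ?_
  by_cases h : Y ω = y <;> simp [h]

lemma le_pr {p : Ω → ℝ} (hp : ∀ ω, 0 ≤ p ω) {α : Type*} (X : Ω → α) (ω : Ω) :
    p ω ≤ pr p X (X ω) := by
  unfold pr
  have := Finset.single_le_sum (f := fun ω' => if X ω' = X ω then p ω' else 0)
    (fun ω' _ => by split_ifs; exacts [hp ω', le_rfl]) (Finset.mem_univ ω)
  simpa using this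

lemma pr_mono_of_imp {p : Ω → ℝ} (hp : ∀ ω, 0 ≤ p ω) {α β : Type*} {X : Ω → α} {Y : Ω → β}
    {x : α} {y : β} (h : ∀ ω, X ω = x → Y ω = y) : pr p X x ≤ pr p Y y := by
  unfold pr
  refine Finset.sum_le_sum fun ω _ => ?_
  have := h ω
  have h0 := hp ω
  split_ifs <;> first | exact le_rfl | exact h0 | tauto

lemma pr_congr_iff (p : Ω → ℝ) {α β : Type*} {X : Ω → α} {Y : Ω → β}
    {x : α} {y : β} (h : ∀ ω, X ω = x ↔ Y ω = y) : pr p X x = pr p Y y := by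
  unfold pr
  simp only [h]

/-- Entropy as an expected self-information. -/
lemma H_eq (p : Ω → ℝ) (X : Ω → α) :
    H p X = ∑ ω, p ω * -Real.logb 2 (pr p X (X ω)) := by
  rw [← sum_pr_mul p X (fun x => -Real.logb 2 (pr p X x))]
  simp [H]

lemma H_congr_iff (p : Ω → ℝ) {X : Ω → α} {Y : Ω → β}
    (h : ∀ ω ω', X ω = X ω' ↔ Y ω = Y ω') : H p X = H p Y := by
  rw [H_eq, H_eq]
  refine Finset.sum_congr rfl fun ω _ => ?_
  rw [pr_congr_iff p fun ω' => h ω' ω]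

lemma Hc_congr_iff (p : Ω → ℝ) {δ : Type*} [Fintype δ] {X : Ω → α} {Y : Ω → β}
    {X' : Ω → γ} {Y' : Ω → δ}
    (h : ∀ ω ω', (X ω = X ω' ∧ Y ω = Y ω') ↔ (X' ω = X' ω' ∧ Y' ω = Y' ω'))
    (h' : ∀ ω ω', Y ω = Y ω' ↔ Y' ω = Y' ω') : Hc p X Y = Hc p X' Y' := by
  unfold Hc
  rw [H_congr_iff p (Y := fun ω => (X' ω, Y' ω)) (by simpa [Prod.ext_iff] using h),
    H_congr_iff p h']

lemma H_le_of_fun {p : Ω → ℝ} (hp : ∀ ω, 0 ≤ p ω) {X : Ω → α} {Y : Ω → β}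
    (h : ∀ ω ω', X ω = X ω' → Y ω = Y ω') : H p Y ≤ H p X := by
  rw [H_eq, H_eq]
  refine Finset.sum_le_sum fun ω _ => ?_
  rcases (hp ω).lt_or_eq with h0 | h0
  · have h1 : 0 < pr p X (X ω) := h0.trans_le (le_pr hp X ω)
    have h2 : pr p X (X ω) ≤ pr p Y (Y ω) := pr_mono_of_imp hp fun ω' => h ω' ω
    have := Real.logb_le_logb_of_le (b := 2) (by norm_num) h1 h2
    nlinarith
  · simp [← h0]

lemma Hc_nonneg {p : Ω → ℝ} (hp : ∀ ω, 0 ≤ p ω) (X : Ω → α) (Y : Ω → β) : 0 ≤ Hc p X Y :=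
  sub_nonneg.2 (H_le_of_fun hp fun _ _ h => (Prod.ext_iff.1 h).2)

lemma Hc_eq {p : Ω → ℝ} (hp : ∀ ω, 0 ≤ p ω) (X : Ω → α) (Y : Ω → β) :
    Hc p X Y = ∑ ω, p ω *
      -Real.logb 2 (pr p (fun ω => (X ω, Y ω)) (X ω, Y ω) / pr p Y (Y ω)) := by
  rw [Hc, H_eq, H_eq, ← Finset.sum_sub_distrib]
  refine Finset.sum_congr rfl fun ω _ => ?_
  rcases (hp ω).lt_or_eq with h0 | h0
  · rw [Real.logb_div (h0.trans_le (le_pr hp (fun ω => (X ω, Y ω)) ω)).ne'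
      (h0.trans_le (le_pr hp Y ω)).ne']
    ring
  · simp [← h0]

lemma neg_logb_le {a r : ℝ} (ha : 0 < a) (hr : 0 < r) :
    -Real.logb 2 a ≤ -Real.logb 2 r + (r / a - 1) / Real.log 2 := by
  have h2 : 0 < Real.log 2 := Real.log_pos (by norm_num)
  have h := Real.log_le_sub_one_of_pos (div_pos hr ha)
  rw [Real.log_div hr.ne' ha.ne'] at h
  unfold Real.logb
  rw [← sub_nonneg]
  have : -(Real.log r / Real.log 2) + (r / a - 1) / Real.log 2 - -(Real.log a / Real.log 2)
      = ((r / a - 1) - (Real.log r - Real.log a)) / Real.log 2 := by ring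
  rw [this]
  exact div_nonneg (by linarith) h2.le

/-- Gibbs' inequality for conditional entropy. -/
lemma Hc_le_cross {p : Ω → ℝ} (hp : ∀ ω, 0 ≤ p ω) (X : Ω → α) (Y : Ω → β) (r : α → β → ℝ)
    (hr0 : ∀ x y, 0 ≤ r x y) (hr : ∀ ω, 0 < p ω → 0 < r (X ω) (Y ω))
    (hr1 : ∀ y, ∑ x, r x y ≤ 1) :
    Hc p X Y ≤ ∑ ω, p ω * -Real.logb 2 (r (X ω) (Y ω)) := by
  have h2 : 0 < Real.log 2 := Real.log_pos (by norm_num)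
  set P := fun x y => pr p (fun ω => (X ω, Y ω)) (x, y) with hP
  have key : ∑ ω, p ω * (r (X ω) (Y ω) / (P (X ω) (Y ω) / pr p Y (Y ω)) - 1) ≤ 0 := by
    have e1 := sum_pr_mul p (fun ω => (X ω, Y ω))
      (fun z => r z.1 z.2 / (P z.1 z.2 / pr p Y z.2) - 1)
    simp only at e1
    rw [← e1]
    have e2 : ∀ z : α × β, pr p (fun ω => (X ω, Y ω)) z *
        (r z.1 z.2 / (P z.1 z.2 / pr p Y z.2) - 1) ≤ r z.1 z.2 * pr p Y z.2 - P z.1 z.2 := by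
      rintro ⟨x, y⟩
      change P x y * _ ≤ _
      have h0 : 0 ≤ P x y := pr_nonneg hp _ _
      have h1 : 0 ≤ pr p Y y := pr_nonneg hp _ _
      rcases h0.lt_or_eq with h | h
      · apply le_of_eq
        simp only
        field_simp
      · simp only [← h, zero_mul, sub_zero]
        exact mul_nonneg (hr0 _ _) h1
    refine (Finset.sum_le_sum fun z _ => e2 z).trans ?_
    rw [Finset.sum_sub_distrib, sub_nonpos, Fintype.sum_prod_type_right, Fintype.sum_prod_type_right]
    refine Finset.sum_le_sum fun y _ => ?_
    simp only
    rw [← Finset.sum_mul, hP, sum_pr_fst]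
    exact mul_le_of_le_one_left (pr_nonneg hp _ _) (hr1 y)
  rw [Hc_eq hp]
  have : ∀ ω, p ω * -Real.logb 2 (P (X ω) (Y ω) / pr p Y (Y ω)) ≤
      p ω * -Real.logb 2 (r (X ω) (Y ω)) +
      p ω * (r (X ω) (Y ω) / (P (X ω) (Y ω) / pr p Y (Y ω)) - 1) / Real.log 2 := by
    intro ω
    rcases (hp ω).lt_or_eq with h0 | h0
    · have := neg_logb_le (div_pos (h0.trans_le (le_pr hp (fun ω => (X ω, Y ω)) ω))
        (h0.trans_le (le_pr hp Y ω))) (hr ω h0)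
      have := mul_le_mul_of_nonneg_left this h0.le
      rw [mul_add] at this
      rw [mul_div_assoc]
      exact this
    · simp [← h0]
  refine (Finset.sum_le_sum fun ω _ => this ω).trans ?_
  rw [Finset.sum_add_distrib, ← Finset.sum_div]
  have := div_nonpos_of_nonpos_of_nonneg key h2.le
  linarith

lemma H_const {p : Ω → ℝ} (hp : IsPMF p) (c : α) : H p (fun _ => c) = 0 := by
  rw [H_eq]
  simp [pr, hp.2]

lemma H_eq_Hc_unit {p : Ω → ℝ} (hp : IsPMF p) (X : Ω → α) :
    H p X = Hc p X (fun _ => ()) := by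
  rw [Hc, H_const hp, sub_zero]
  exact H_congr_iff p (by simp)

/-- Gibbs' inequality. -/
lemma H_le_cross {p : Ω → ℝ} (hp : IsPMF p) (X : Ω → α) (r : α → ℝ)
    (hr0 : ∀ x, 0 < r x) (hr1 : ∑ x, r x ≤ 1) :
    H p X ≤ ∑ ω, p ω * -Real.logb 2 (r (X ω)) := by
  rw [H_eq_Hc_unit hp]
  exact Hc_le_cross hp.1 X _ (fun x _ => r x) (fun x _ => (hr0 x).le) (fun ω _ => hr0 _)
    (fun _ => hr1)

lemma Hc_le_logb_card [Nonempty α] {p : Ω → ℝ} (hp : IsPMF p) (X : Ω → α) (Y : Ω → β) :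
    Hc p X Y ≤ Real.logb 2 (Fintype.card α) := by
  have hc : (0 : ℝ) < Fintype.card α := by exact_mod_cast Fintype.card_pos
  have := Hc_le_cross hp.1 X Y (fun _ _ => (Fintype.card α : ℝ)⁻¹) (fun _ _ => by positivity)
    (fun _ _ => by positivity) (fun _ => by simp)
  simpa [Real.logb_inv, ← Finset.sum_mul, hp.2] using this

/-- Concavity of the conditional entropy in the joint distribution. -/
lemma sum_mul_Hc_le {κ : Type*} [Fintype κ] {w : κ → ℝ} (hw : ∀ k, 0 ≤ w k)
    {P : κ → Ω → ℝ} (hP : ∀ k ω, 0 ≤ P k ω) {Q : Ω → ℝ} (hQ : ∀ ω, Q ω = ∑ k, w k * P k ω)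
    (X : Ω → α) (Y : Ω → β) : ∑ k, w k * Hc (P k) X Y ≤ Hc Q X Y := by
  have hQ0 : ∀ ω, 0 ≤ Q ω := fun ω => by
    rw [hQ]; exact Finset.sum_nonneg fun k _ => mul_nonneg (hw k) (hP k ω)
  set R := fun (x : α) (y : β) => pr Q (fun ω => (X ω, Y ω)) (x, y) / pr Q Y y with hR
  have hk : ∀ k, w k * Hc (P k) X Y ≤ ∑ ω, w k * P k ω * -Real.logb 2 (R (X ω) (Y ω)) := by
    intro k
    rcases (hw k).lt_or_eq with h0 | h0
    · simp_rw [mul_assoc, ← Finset.mul_sum]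
      refine mul_le_mul_of_nonneg_left ?_ h0.le
      refine Hc_le_cross (hP k) X Y R ?_ ?_ ?_
      · exact fun x y => div_nonneg (pr_nonneg hQ0 _ _) (pr_nonneg hQ0 _ _)
      · intro ω h
        have : 0 < Q ω := by
          rw [hQ]
          exact (mul_pos h0 h).trans_le (Finset.single_le_sum (f := fun k => w k * P k ω)
            (fun k _ => mul_nonneg (hw k) (hP k ω)) (Finset.mem_univ k))
        exact div_pos (this.trans_le (le_pr hQ0 (fun ω => (X ω, Y ω)) ω))
          (this.trans_le (le_pr hQ0 Y ω))
      · intro y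
        rw [hR]
        simp only
        rw [← Finset.sum_div, sum_pr_fst]
        exact div_self_le_one _
    · simp [← h0]
  refine (Finset.sum_le_sum fun k _ => hk k).trans (le_of_eq ?_)
  rw [Finset.sum_comm, Hc_eq hQ0]
  refine Finset.sum_congr rfl fun ω _ => ?_
  rw [← Finset.sum_mul, ← hQ]

lemma pr_pr (p : Ω → ℝ) (e : Ω → Ω') {α : Type*} (X : Ω' → α) (x : α) :
    pr (pr p e) X x = pr p (fun ω => X (e ω)) x := by
  have := sum_pr_mul p e (fun ω' => if X ω' = x then 1 else 0)
  simpa [pr] using this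

lemma H_pr (p : Ω → ℝ) (e : Ω → Ω') (X : Ω' → α) :
    H (pr p e) X = H p (fun ω => X (e ω)) := by
  simp only [H, pr_pr]

lemma Hc_pr (p : Ω → ℝ) (e : Ω → Ω') (X : Ω' → α) (Y : Ω' → β) :
    Hc (pr p e) X Y = Hc p (fun ω => X (e ω)) (fun ω => Y (e ω)) := by
  simp only [Hc, H_pr]

lemma prE_pr (p : Ω → ℝ) (e : Ω → Ω') (s : Ω' → Prop) :
    prE (pr p e) s = prE p (fun ω => s (e ω)) := by
  have := sum_pr_mul p e (fun ω' => if s ω' then 1 else 0)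
  simpa [prE] using this

lemma pr_equiv {Ω Ω' : Type*} [Fintype Ω] (p : Ω → ℝ) (e : Ω ≃ Ω') (p' : Ω' → ℝ) (h : ∀ ω, p' (e ω) = p ω) :
    pr p e = p' := by
  funext ω'
  obtain ⟨ω, rfl⟩ := e.surjective ω'
  simp [pr, h]

end Basic

section Product

open scoped Classical

variable {ι S : Type*} [Fintype ι] [DecidableEq ι] [Fintype S]

lemma sum_prod_eq (h : ι → S → ℝ) : ∑ ω : ι → S, ∏ i, h i (ω i) = ∏ i, ∑ s, h i s := by
  rw [Finset.prod_univ_sum, Fintype.piFinset_univ]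

lemma sum_prod_mul {p : ι → S → ℝ} (hp : ∀ i, ∑ s, p i s = 1) (i : ι) (F : S → ℝ) :
    ∑ ω : ι → S, (∏ j, p j (ω j)) * F (ω i) = ∑ s, p i s * F s := by
  have h := sum_prod_eq (fun j s => p j s * if j = i then F s else 1)
  simp_rw [Finset.prod_mul_distrib, Finset.prod_ite_eq' Finset.univ i, Finset.mem_univ,
    if_true] at h
  rw [h, Finset.prod_eq_single i]
  · simp
  · intro j _ hj
    simp [hj, hp]
  · simp

lemma sum_prod_mul_mul {p : ι → S → ℝ} (hp : ∀ i, ∑ s, p i s = 1) {i j : ι} (hij : i ≠ j)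
    (F G : S → ℝ) :
    ∑ ω : ι → S, (∏ k, p k (ω k)) * (F (ω i) * G (ω j)) =
      (∑ s, p i s * F s) * ∑ s, p j s * G s := by
  have h := sum_prod_eq
    (fun k s => p k s * ((if k = i then F s else 1) * if k = j then G s else 1))
  simp_rw [Finset.prod_mul_distrib, Finset.prod_ite_eq' Finset.univ, Finset.mem_univ,
    if_true] at h
  rw [h, ← Finset.prod_mul_prod_compl ({i, j} : Finset ι), Finset.prod_pair hij,
    Finset.prod_eq_one, mul_one]
  · simp [hij, hij.symm]
  · intro k hk
    simp only [Finset.mem_compl, Finset.mem_insert, Finset.mem_singleton, not_or] at hk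
    simp [hk.1, hk.2, hp]

lemma isPMF_prod {p : ι → S → ℝ} (hp : ∀ i, IsPMF (p i)) :
    IsPMF (fun ω : ι → S => ∏ i, p i (ω i)) :=
  ⟨fun ω => Finset.prod_nonneg fun i _ => (hp i).1 _, by
    rw [sum_prod_eq]; exact Finset.prod_eq_one fun i _ => (hp i).2⟩

lemma isPMF_blk {p : S → ℝ} (hp : IsPMF p) (N : ℕ) : IsPMF (blk N p) :=
  isPMF_prod (ι := Fin N) fun _ => hp

/-- Second moment of the deviation of a sum of i.i.d. random variables. -/
lemma sum_prod_mul_sq {q : S → ℝ} (hq : IsPMF q) {f : S → ℝ} (hf : ∑ s, q s * f s = 0) :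
    ∑ ω : ι → S, (∏ i, q (ω i)) * (∑ i, f (ω i)) ^ 2 =
      Fintype.card ι * ∑ s, q s * f s ^ 2 := by
  have h : ∀ i j : ι, ∑ ω : ι → S, (∏ k, q (ω k)) * (f (ω i) * f (ω j)) =
      if i = j then ∑ s, q s * f s ^ 2 else 0 := by
    intro i j
    split_ifs with hij
    · subst hij
      simpa [sq] using sum_prod_mul (p := fun _ : ι => q) (fun _ => hq.2) i (fun s => f s * f s)
    · simpa [hf] using sum_prod_mul_mul (p := fun _ : ι => q) (fun _ => hq.2) hij f f
  simp_rw [sq, Finset.sum_mul_sum, Finset.mul_sum]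
  rw [Finset.sum_comm]
  simp_rw [Finset.sum_comm (s := (Finset.univ : Finset (ι → S))), h]
  simp [sq, Finset.mul_sum]

lemma sum_blk_sum {q : S → ℝ} (hq : IsPMF q) (N : ℕ) (f : S → ℝ) :
    ∑ ω, blk N q ω * ∑ i, f (ω i) = N * ∑ s, q s * f s := by
  simp_rw [Finset.mul_sum]
  rw [Finset.sum_comm]
  have := fun i : Fin N => sum_prod_mul (p := fun _ : Fin N => q) (fun _ => hq.2) i f
  unfold blk
  simp [this, Finset.mul_sum]

/-- Chebyshev's inequality for sums of i.i.d. random variables. -/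
lemma prE_blk_le {q : S → ℝ} (hq : IsPMF q) (f : S → ℝ) {N : ℕ} (hN : 0 < N) {δ : ℝ}
    (hδ : 0 < δ) :
    prE (blk N q) (fun ω => N * (∑ s, q s * f s + δ) < ∑ i, f (ω i)) ≤
      (∑ s, q s * (f s - ∑ s, q s * f s) ^ 2) / (N * δ ^ 2) := by
  have hN' : (0 : ℝ) < N := by exact_mod_cast hN
  set m := ∑ s, q s * f s with hm
  have h0 : ∑ s, q s * (f s - m) = 0 := by
    simp_rw [mul_sub]
    rw [Finset.sum_sub_distrib, ← Finset.sum_mul, hq.2, ← hm]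
    ring
  have h1 := sum_prod_mul_sq (ι := Fin N) hq h0
  rw [Fintype.card_fin] at h1
  have h2 : prE (blk N q) (fun ω => N * (m + δ) < ∑ i, f (ω i)) * (N * δ) ^ 2 ≤
      ∑ ω : Fin N → S, (∏ i, q (ω i)) * (∑ i, (f (ω i) - m)) ^ 2 := by
    unfold prE
    rw [Finset.sum_mul]
    refine Finset.sum_le_sum fun ω _ => ?_
    have hb : 0 ≤ blk N q ω := (isPMF_blk hq N).1 ω
    split_ifs with h
    · refine mul_le_mul_of_nonneg_left ?_ hb
      have : ∑ i, (f (ω i) - m) = ∑ i, f (ω i) - N * m := by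
        rw [Finset.sum_sub_distrib]; simp
      refine pow_le_pow_left₀ (by positivity) ?_ 2
      rw [this]
      linarith
    · rw [zero_mul]
      exact mul_nonneg hb (sq_nonneg _)
  rw [h1] at h2
  rw [le_div_iff₀ (by positivity)]
  have : (N : ℝ) * (prE (blk N q) (fun ω => N * (m + δ) < ∑ i, f (ω i)) * (N * δ ^ 2)) ≤
      N * ∑ s, q s * (f s - m) ^ 2 := by
    refine le_trans (le_of_eq (by ring)) h2
  exact le_of_mul_le_mul_left this hN'

/-- One-sided weak law of large numbers. -/
lemma exists_prE_blk_le {q : S → ℝ} (hq : IsPMF q) (f : S → ℝ) {δ ε : ℝ} (hδ : 0 < δ)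
    (hε : 0 < ε) : ∃ N₀ : ℕ, ∀ N ≥ N₀,
      prE (blk N q) (fun ω => N * (∑ s, q s * f s + δ) < ∑ i, f (ω i)) ≤ ε := by
  set v := ∑ s, q s * (f s - ∑ s, q s * f s) ^ 2 with hv
  obtain ⟨N₀, hN₀⟩ := exists_nat_gt (v / (ε * δ ^ 2))
  refine ⟨N₀ + 1, fun N hN => (prE_blk_le hq f (by omega) hδ).trans ?_⟩
  have h1 : (N₀ : ℝ) ≤ N := by exact_mod_cast (by omega : N₀ ≤ N)
  have h2 : (0 : ℝ) < N := by exact_mod_cast (by omega : 0 < N)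
  rw [← hv, div_le_iff₀ (by positivity)]
  rw [div_lt_iff₀ (by positivity)] at hN₀
  nlinarith [mul_pos hε (pow_pos hδ 2)]

lemma pr_blk (N : ℕ) (p : S → ℝ) {α : Type*} (X : S → α) (x : Fin N → α) :
    pr (blk N p) (fun ω i => X (ω i)) x = ∏ i, pr p X (x i) := by
  unfold pr
  rw [← sum_prod_eq (fun i s => if X s = x i then p s else 0)]
  refine Finset.sum_congr rfl fun ω _ => ?_
  by_cases h : (fun i => X (ω i)) = x
  · subst h
    simp [blk]
  · rw [if_neg h]
    obtain ⟨i, hi⟩ := Function.ne_iff.1 h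
    exact (Finset.prod_eq_zero (Finset.mem_univ i) (if_neg hi)).symm

lemma H_blk {p : S → ℝ} (hp : IsPMF p) (N : ℕ) {α : Type*} [Fintype α] (X : S → α) :
    H (blk N p) (fun ω i => X (ω i)) = N * H p X := by
  rw [H_eq, H_eq p, ← sum_blk_sum hp]
  refine Finset.sum_congr rfl fun ω _ => ?_
  rcases ((isPMF_blk hp N).1 ω).lt_or_eq with h | h
  · rw [pr_blk, Real.logb_prod, Finset.sum_neg_distrib]
    intro i _ h0
    have h1 : p (ω i) ≤ 0 := h0 ▸ le_pr hp.1 X (ω i)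
    have h2 : p (ω i) = 0 := le_antisymm h1 (hp.1 _)
    exact h.ne' (Finset.prod_eq_zero (Finset.mem_univ i) h2)
  · simp [← h]

lemma Hc_blk {p : S → ℝ} (hp : IsPMF p) (N : ℕ) {α β : Type*} [Fintype α] [Fintype β]
    (X : S → α) (Y : S → β) :
    Hc (blk N p) (fun ω i => X (ω i)) (fun ω i => Y (ω i)) = N * Hc p X Y := by
  rw [Hc, Hc, mul_sub, ← H_blk hp, ← H_blk hp]
  rw [H_congr_iff (blk N p) (Y := fun ω i => (X (ω i), Y (ω i)))]
  intro ω ω'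
  simp only [Prod.ext_iff, funext_iff]
  exact forall_and.symm

end Product

section Codes

/-- There is a code for the one-shot source `(X, Z, E)` under the pmf `p` whose message sizes (in
bits) are at most `a` and `c`, with equivocation at least `d` and error probability at most `e`. -/
def Code {Ω 𝒳 𝒵 ℰ : Type*} [Fintype Ω] [Fintype 𝒳] [Fintype 𝒵] [Fintype ℰ] (p : Ω → ℝ)
    (X : Ω → 𝒳) (Z : Ω → 𝒵) (E : Ω → ℰ) (a c d e : ℝ) : Prop :=
  ∃ (MA MC : ℕ), 0 < MA ∧ 0 < MC ∧ ∃ (fA : 𝒳 → Fin MA) (fC : 𝒵 → Fin MC)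
    (g : Fin MA → Fin MC → 𝒳 × 𝒵),
    Real.logb 2 (MA : ℝ) ≤ a ∧ Real.logb 2 (MC : ℝ) ≤ c ∧
    d ≤ Hc p X (fun ω => (fA (X ω), E ω)) ∧
    prE p (fun ω => g (fA (X ω)) (fC (Z ω)) ≠ (X ω, Z ω)) ≤ e

variable {Ω 𝒳 𝒵 ℰ Ω' 𝒳' 𝒵' ℰ' : Type*} [Fintype Ω] [Fintype 𝒳] [Fintype 𝒵] [Fintype ℰ]
  [Fintype Ω'] [Fintype 𝒳'] [Fintype 𝒵'] [Fintype ℰ']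

lemma Code.of_types {μ ν : Type*} [Fintype μ] [Fintype ν] [Nonempty μ] [Nonempty ν] {p : Ω → ℝ}
    {X : Ω → 𝒳} {Z : Ω → 𝒵} {E : Ω → ℰ} {a c d e : ℝ} (fA : 𝒳 → μ) (fC : 𝒵 → ν)
    (g : μ → ν → 𝒳 × 𝒵) (ha : Real.logb 2 (Fintype.card μ) ≤ a)
    (hc : Real.logb 2 (Fintype.card ν) ≤ c) (hd : d ≤ Hc p X (fun ω => (fA (X ω), E ω)))
    (he : prE p (fun ω => g (fA (X ω)) (fC (Z ω)) ≠ (X ω, Z ω)) ≤ e) :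
    Code p X Z E a c d e := by
  refine ⟨Fintype.card μ, Fintype.card ν, Fintype.card_pos, Fintype.card_pos,
    fun x => Fintype.equivFin μ (fA x), fun z => Fintype.equivFin ν (fC z),
    fun i j => g ((Fintype.equivFin μ).symm i) ((Fintype.equivFin ν).symm j), ha, hc, ?_, ?_⟩
  · refine hd.trans (le_of_eq (Hc_congr_iff p ?_ ?_)) <;> simp
  · simpa using he

lemma Code.mono {p : Ω → ℝ} {X : Ω → 𝒳} {Z : Ω → 𝒵} {E : Ω → ℰ} {a c d e a' c' d' e' : ℝ}
    (h : Code p X Z E a c d e) (ha : a ≤ a') (hc : c ≤ c') (hd : d' ≤ d) (he : e ≤ e') :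
    Code p X Z E a' c' d' e' := by
  obtain ⟨MA, MC, h1, h2, fA, fC, g, h3, h4, h5, h6⟩ := h
  exact ⟨MA, MC, h1, h2, fA, fC, g, h3.trans ha, h4.trans hc, hd.trans h5, h6.trans he⟩

/-- Codes can be transported along a relabelling of the sample space and of the alphabets. -/
lemma Code.relabel {p : Ω → ℝ} {X : Ω → 𝒳} {Z : Ω → 𝒵} {E : Ω → ℰ} {a c d e : ℝ}
    (h : Code p X Z E a c d e) (f : Ω ≃ Ω') (kX : 𝒳 ≃ 𝒳') (kZ : 𝒵 ≃ 𝒵') (kE : ℰ ≃ ℰ')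
    {p' : Ω' → ℝ} {X' : Ω' → 𝒳'} {Z' : Ω' → 𝒵'} {E' : Ω' → ℰ'} (hp : ∀ ω, p' (f ω) = p ω)
    (hX : ∀ ω, X' (f ω) = kX (X ω)) (hZ : ∀ ω, Z' (f ω) = kZ (Z ω))
    (hE : ∀ ω, E' (f ω) = kE (E ω)) : Code p' X' Z' E' a c d e := by
  obtain ⟨MA, MC, h1, h2, fA, fC, g, h3, h4, h5, h6⟩ := h
  refine ⟨MA, MC, h1, h2, fun x => fA (kX.symm x), fun z => fC (kZ.symm z),
    fun i j => (kX (g i j).1, kZ (g i j).2), h3, h4, ?_, ?_⟩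
  · rw [← pr_equiv p f p' hp, Hc_pr]
    refine h5.trans (le_of_eq (Hc_congr_iff p ?_ ?_)) <;> simp [hX, hE]
  · rw [← pr_equiv p f p' hp, prE_pr]
    simpa [hX, hZ, Prod.ext_iff] using h6

lemma pr_prod (p : Ω → ℝ) (p' : Ω' → ℝ) {α β : Type*} (X : Ω → α) (Y : Ω' → β) (x : α) (y : β) :
    pr (fun w : Ω × Ω' => p w.1 * p' w.2) (fun w => (X w.1, Y w.2)) (x, y) =
      pr p X x * pr p' Y y := by
  unfold pr
  rw [Finset.sum_mul_sum, Fintype.sum_prod_type]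
  refine Finset.sum_congr rfl fun ω _ => Finset.sum_congr rfl fun ω' _ => ?_
  by_cases h1 : X ω = x <;> by_cases h2 : Y ω' = y <;> simp [h1, h2]

lemma isPMF_mul {p : Ω → ℝ} {p' : Ω' → ℝ} (hp : IsPMF p) (hp' : IsPMF p') :
    IsPMF (fun w : Ω × Ω' => p w.1 * p' w.2) := by
  refine ⟨fun w => mul_nonneg (hp.1 _) (hp'.1 _), ?_⟩
  rw [Fintype.sum_prod_type, ← Finset.sum_mul_sum, hp.2, hp'.2, one_mul]

lemma H_prod {p : Ω → ℝ} {p' : Ω' → ℝ} (hp : IsPMF p) (hp' : IsPMF p') {α β : Type*} [Fintype α]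
    [Fintype β] (X : Ω → α) (Y : Ω' → β) :
    H (fun w : Ω × Ω' => p w.1 * p' w.2) (fun w => (X w.1, Y w.2)) = H p X + H p' Y := by
  rw [H_eq, H_eq, H_eq, Fintype.sum_prod_type]
  have : ∀ ω ω', p ω * p' ω' * -Real.logb 2 (pr (fun w : Ω × Ω' => p w.1 * p' w.2)
      (fun w => (X w.1, Y w.2)) (X ω, Y ω')) =
      p ω * -Real.logb 2 (pr p X (X ω)) * p' ω' + p ω * (p' ω' * -Real.logb 2 (pr p' Y (Y ω'))) := by
    intro ω ω'
    rcases (hp.1 ω).lt_or_eq with h0 | h0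
    · rcases (hp'.1 ω').lt_or_eq with h1 | h1
      · rw [pr_prod, Real.logb_mul (h0.trans_le (le_pr hp.1 X ω)).ne'
          (h1.trans_le (le_pr hp'.1 Y ω')).ne']
        ring
      · simp [← h1]
    · simp [← h0]
  simp_rw [this, Finset.sum_add_distrib, ← Finset.mul_sum, hp'.2, mul_one, ← Finset.sum_mul, hp.2,
    one_mul]

lemma Hc_prod {p : Ω → ℝ} {p' : Ω' → ℝ} (hp : IsPMF p) (hp' : IsPMF p') {α β γ δ : Type*}
    [Fintype α] [Fintype β] [Fintype γ] [Fintype δ] (X : Ω → α) (Y : Ω → β)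
    (X' : Ω' → γ) (Y' : Ω' → δ) :
    Hc (fun w : Ω × Ω' => p w.1 * p' w.2) (fun w => (X w.1, X' w.2)) (fun w => (Y w.1, Y' w.2)) =
      Hc p X Y + Hc p' X' Y' := by
  rw [Hc, Hc, Hc, H_prod hp hp', H_congr_iff (Y := fun w : Ω × Ω' => ((X w.1, Y w.1),
    (X' w.2, Y' w.2))), H_prod hp hp' (fun ω => (X ω, Y ω)) (fun ω => (X' ω, Y' ω))]
  · ring
  · simp only [Prod.ext_iff]
    tauto

lemma prE_fst {p : Ω → ℝ} {p' : Ω' → ℝ} (hp' : IsPMF p') (s : Ω → Prop) :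
    prE (fun w : Ω × Ω' => p w.1 * p' w.2) (fun w => s w.1) = prE p s := by
  unfold prE
  rw [Fintype.sum_prod_type]
  refine Finset.sum_congr rfl fun ω _ => ?_
  by_cases h : s ω <;> simp [h, ← Finset.mul_sum, hp'.2]

lemma prE_snd {p : Ω → ℝ} {p' : Ω' → ℝ} (hp : IsPMF p) (s : Ω' → Prop) :
    prE (fun w : Ω × Ω' => p w.1 * p' w.2) (fun w => s w.2) = prE p' s := by
  unfold prE
  rw [Fintype.sum_prod_type_right]
  refine Finset.sum_congr rfl fun ω _ => ?_
  by_cases h : s ω <;> simp [h, ← Finset.sum_mul, hp.2]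

/-- Two codes for independent sources can be used side by side. -/
lemma Code.prod {p : Ω → ℝ} {p' : Ω' → ℝ} (hp : IsPMF p) (hp' : IsPMF p')
    {X : Ω → 𝒳} {Z : Ω → 𝒵} {E : Ω → ℰ} {a c d e : ℝ} (h : Code p X Z E a c d e)
    {X' : Ω' → 𝒳'} {Z' : Ω' → 𝒵'} {E' : Ω' → ℰ'} {a' c' d' e' : ℝ}
    (h' : Code p' X' Z' E' a' c' d' e') :
    Code (fun w : Ω × Ω' => p w.1 * p' w.2) (fun w => (X w.1, X' w.2)) (fun w => (Z w.1, Z' w.2))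
      (fun w => (E w.1, E' w.2)) (a + a') (c + c') (d + d') (e + e') := by
  obtain ⟨MA, MC, h1, h2, fA, fC, g, h3, h4, h5, h6⟩ := h
  obtain ⟨MA', MC', h1', h2', fA', fC', g', h3', h4', h5', h6'⟩ := h'
  have : Nonempty (Fin MA) := ⟨⟨0, h1⟩⟩
  have : Nonempty (Fin MC) := ⟨⟨0, h2⟩⟩
  have : Nonempty (Fin MA') := ⟨⟨0, h1'⟩⟩
  have : Nonempty (Fin MC') := ⟨⟨0, h2'⟩⟩
  have hlog : ∀ {m n : ℕ}, 0 < m → 0 < n → Real.logb 2 ((m * n : ℕ) : ℝ) =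
      Real.logb 2 m + Real.logb 2 n := fun hm hn => by
    push_cast
    exact Real.logb_mul (by positivity) (by positivity)
  refine Code.of_types (fun x => (fA x.1, fA' x.2)) (fun z => (fC z.1, fC' z.2))
    (fun i j => (((g i.1 j.1).1, (g' i.2 j.2).1), ((g i.1 j.1).2, (g' i.2 j.2).2))) ?_ ?_ ?_ ?_
  · rw [Fintype.card_prod, Fintype.card_fin, Fintype.card_fin, hlog h1 h1']
    exact add_le_add h3 h3'
  · rw [Fintype.card_prod, Fintype.card_fin, Fintype.card_fin, hlog h2 h2']
    exact add_le_add h4 h4'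
  · refine (add_le_add h5 h5').trans (le_of_eq ?_)
    rw [← Hc_prod hp hp']
    refine Hc_congr_iff _ ?_ ?_ <;> simp only [Prod.ext_iff] <;> tauto
  · have hpm := isPMF_mul hp hp'
    rw [← prE_fst (p := p) hp'] at h6
    rw [← prE_snd (p' := p') hp] at h6'
    refine le_trans ?_ (add_le_add h6 h6')
    refine le_trans (prE_mono hpm.1 ?_) (prE_or_le hpm.1 _ _)
    rintro ⟨ω, ω'⟩ _ h
    simp only [ne_eq, Prod.ext_iff] at h ⊢
    tauto

end Codes

section BlockCodes

variable {Ω 𝒳 𝒵 ℰ : Type*} [Fintype Ω] [Fintype 𝒳] [Fintype 𝒵] [Fintype ℰ]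

/-- `Code` for the `N`-fold i.i.d. extension of a source. -/
abbrev BlockCode (N : ℕ) (p : Ω → ℝ) (X : Ω → 𝒳) (Z : Ω → 𝒵) (E : Ω → ℰ) (a c d e : ℝ) : Prop :=
  Code (blk N p) (fun ω i => X (ω i)) (fun ω i => Z (ω i)) (fun ω i => E (ω i)) a c d e

lemma comp_append {Ω α : Type*} (W : Ω → α) {m n : ℕ} (w : (Fin m → Ω) × (Fin n → Ω)) :
    (fun i => W (Fin.append w.1 w.2 i)) =
      Fin.append (fun i => W (w.1 i)) (fun i => W (w.2 i)) := by
  funext i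
  refine Fin.addCases (fun i => ?_) (fun i => ?_) i <;> simp

lemma BlockCode.append {p : Ω → ℝ} (hp : IsPMF p) {X : Ω → 𝒳} {Z : Ω → 𝒵} {E : Ω → ℰ}
    {m n : ℕ} {a c d e a' c' d' e' : ℝ} (h : BlockCode m p X Z E a c d e)
    (h' : BlockCode n p X Z E a' c' d' e') :
    BlockCode (m + n) p X Z E (a + a') (c + c') (d + d') (e + e') := by
  refine (Code.prod (isPMF_blk hp m) (isPMF_blk hp n) h h').relabel
    (Fin.appendEquiv m n) (Fin.appendEquiv m n) (Fin.appendEquiv m n) (Fin.appendEquiv m n)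
    (fun w => ?_) (fun w => comp_append X w) (fun w => comp_append Z w) (fun w => comp_append E w)
  simp [blk, Fin.appendEquiv, Fin.prod_univ_add]

lemma BlockCode.flatten {p : Ω → ℝ} {X : Ω → 𝒳} {Z : Ω → 𝒵} {E : Ω → ℰ}
    {m n : ℕ} {a c d e : ℝ}
    (h : BlockCode m (blk n p) (fun ω i => X (ω i)) (fun ω i => Z (ω i)) (fun ω i => E (ω i))
      a c d e) :
    BlockCode (m * n) p X Z E a c d e := by
  refine h.relabel ((Equiv.curry _ _ _).symm.trans (finProdFinEquiv.arrowCongr (Equiv.refl _)))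
    ((Equiv.curry _ _ _).symm.trans (finProdFinEquiv.arrowCongr (Equiv.refl _)))
    ((Equiv.curry _ _ _).symm.trans (finProdFinEquiv.arrowCongr (Equiv.refl _)))
    ((Equiv.curry _ _ _).symm.trans (finProdFinEquiv.arrowCongr (Equiv.refl _)))
    (fun w => ?_) (fun w => rfl) (fun w => rfl) (fun w => rfl)
  unfold blk
  rw [← Fintype.prod_prod_type' (f := fun i j => p (w i j))]
  refine Fintype.prod_equiv finProdFinEquiv.symm _ _ fun i => ?_
  rfl

/-- Sending the source uncoded. -/
lemma BlockCode.uncoded [Nonempty 𝒳] [Nonempty 𝒵] {p : Ω → ℝ} (hp : IsPMF p) (n : ℕ)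
    (X : Ω → 𝒳) (Z : Ω → 𝒵) (E : Ω → ℰ) :
    BlockCode n p X Z E (n * Real.logb 2 (Fintype.card 𝒳)) (n * Real.logb 2 (Fintype.card 𝒵))
      0 0 := by
  refine Code.of_types (μ := Fin n → 𝒳) (ν := Fin n → 𝒵) id id Prod.mk ?_ ?_
    (Hc_nonneg (isPMF_blk hp n).1 _ _) ?_
  · simp [Real.logb_pow]
  · simp [Real.logb_pow]
  · simp [prE]

end BlockCodes

section Binning

lemma exists_le_of_weighted {κ : Type*} [Fintype κ] {w : κ → ℝ} (hw : IsPMF w) {F : κ → ℝ} {c : ℝ}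
    (h : ∑ k, w k * F k ≤ c) : ∃ k, F k ≤ c := by
  by_contra! hc
  have h1 : ∀ k, w k * c ≤ w k * F k := fun k => mul_le_mul_of_nonneg_left (hc k).le (hw.1 k)
  have h2 : ∃ k, 0 < w k := by
    by_contra! h3
    have := hw.2
    have h4 := Finset.sum_nonpos fun k (_ : k ∈ Finset.univ) => h3 k
    linarith
  obtain ⟨k, hk⟩ := h2
  have := Finset.sum_lt_sum (fun k (_ : k ∈ Finset.univ) => h1 k)
    ⟨k, Finset.mem_univ k, mul_lt_mul_of_pos_left (hc k) hk⟩
  rw [← Finset.sum_mul, hw.2, one_mul] at this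
  linarith

lemma isPMF_uniform {M : ℕ} (hM : 0 < M) : IsPMF (fun _ : Fin M => (M : ℝ)⁻¹) := by
  have : (M : ℝ) ≠ 0 := by positivity
  exact ⟨fun _ => by positivity, by simp [this]⟩

/-- The collision probability of a uniformly random function. -/
lemma sum_uniform_collision {𝒳 : Type*} [Fintype 𝒳] [DecidableEq 𝒳] {M : ℕ} (hM : 0 < M)
    {x x' : 𝒳} (h : x ≠ x') :
    ∑ f : 𝒳 → Fin M, (∏ _ : 𝒳, (M : ℝ)⁻¹) * (if f x = f x' then 1 else 0) = (M : ℝ)⁻¹ := by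
  have hM' : (M : ℝ) ≠ 0 := by positivity
  have e : ∀ f : 𝒳 → Fin M, (if f x = f x' then (1 : ℝ) else 0) =
      ∑ j, (if f x = j then 1 else 0) * (if f x' = j then 1 else 0) := fun f => by
    simp [eq_comm]
  simp_rw [e, Finset.mul_sum]
  rw [Finset.sum_comm]
  have := fun j : Fin M => sum_prod_mul_mul (p := fun (_ : 𝒳) (_ : Fin M) => (M : ℝ)⁻¹)
    (fun _ => (isPMF_uniform hM).2) h (fun s => if s = j then 1 else 0)
    (fun s => if s = j then 1 else 0)
  simp_rw [this]
  simp [hM']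

variable {Ω 𝒳 𝒴 : Type*} [Fintype Ω] [Fintype 𝒳] [Fintype 𝒴]

open scoped Classical in
/-- One-shot source coding with side information at the decoder. -/
lemma exists_binning_oneshot {𝒴 : Type*} [Nonempty 𝒳] {p : Ω → ℝ} (hp : IsPMF p) (X : Ω → 𝒳)
    (Y : Ω → 𝒴) {M : ℕ} (hM : 0 < M) {τ : ℝ} (hτ : 0 < τ) :
    ∃ (f : 𝒳 → Fin M) (g : Fin M → 𝒴 → 𝒳),
      prE p (fun ω => g (f (X ω)) (Y ω) ≠ X ω) ≤
        prE p (fun ω => τ * pr p (fun ω => (X ω, Y ω)) (X ω, Y ω) < pr p Y (Y ω)) + τ / M := by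
  set L : 𝒴 → Finset 𝒳 := fun y => Finset.univ.filter
    fun x => pr p Y y ≤ τ * pr p (fun ω => (X ω, Y ω)) (x, y) with hL
  have hcard : ∀ y, 0 < pr p Y y → ((L y).card : ℝ) ≤ τ := by
    intro y hy
    have h1 : ((L y).card : ℝ) * pr p Y y ≤
        ∑ x ∈ L y, τ * pr p (fun ω => (X ω, Y ω)) (x, y) := by
      rw [← nsmul_eq_mul]
      exact Finset.card_nsmul_le_sum _ _ _ fun x hx => (Finset.mem_filter.1 hx).2
    have h2 : ∑ x ∈ L y, τ * pr p (fun ω => (X ω, Y ω)) (x, y) ≤ τ * pr p Y y := by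
      rw [← Finset.mul_sum, ← sum_pr_fst p X Y y]
      exact mul_le_mul_of_nonneg_left (Finset.sum_le_sum_of_subset_of_nonneg
        (Finset.subset_univ _) fun x _ _ => pr_nonneg hp.1 _ _) hτ.le
    exact le_of_mul_le_mul_right (h1.trans h2) hy
  set col : (𝒳 → Fin M) → ℝ := fun f =>
    ∑ ω, p ω * ∑ x ∈ (L (Y ω)).erase (X ω), if f x = f (X ω) then 1 else 0 with hcol
  have havg : ∑ f : 𝒳 → Fin M, (∏ _ : 𝒳, (M : ℝ)⁻¹) * col f ≤ τ / M := by
    have e1 : ∑ f : 𝒳 → Fin M, (∏ _ : 𝒳, (M : ℝ)⁻¹) * col f =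
        ∑ ω, p ω * ∑ x ∈ (L (Y ω)).erase (X ω), (M : ℝ)⁻¹ := by
      simp_rw [hcol, Finset.mul_sum]
      rw [Finset.sum_comm]
      refine Finset.sum_congr rfl fun ω _ => ?_
      rw [Finset.sum_comm]
      refine Finset.sum_congr rfl fun x hx => ?_
      conv_rhs => rw [← sum_uniform_collision hM (Finset.ne_of_mem_erase hx), Finset.mul_sum]
      exact Finset.sum_congr rfl fun f _ => by ring
    rw [e1]
    have e2 : ∀ ω, p ω * ∑ x ∈ (L (Y ω)).erase (X ω), (M : ℝ)⁻¹ ≤ p ω * (τ / M) := by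
      intro ω
      rcases (hp.1 ω).lt_or_eq with h0 | h0
      · refine mul_le_mul_of_nonneg_left ?_ h0.le
        rw [Finset.sum_const, nsmul_eq_mul, div_eq_mul_inv]
        refine mul_le_mul_of_nonneg_right ?_ (by positivity)
        refine le_trans ?_ (hcard (Y ω) (h0.trans_le (le_pr hp.1 Y ω)))
        exact_mod_cast Finset.card_le_card (Finset.erase_subset _ _)
      · simp [← h0]
    refine (Finset.sum_le_sum fun ω _ => e2 ω).trans ?_
    rw [← Finset.sum_mul, hp.2, one_mul]
  obtain ⟨f, hf⟩ := exists_le_of_weighted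
    (isPMF_prod (ι := 𝒳) fun _ => isPMF_uniform hM) havg
  refine ⟨f, fun j y => if h : ∃ x ∈ L y, f x = j then h.choose else Classical.arbitrary 𝒳,
    le_trans ?_ (add_le_add le_rfl hf)⟩
  unfold prE
  rw [hcol, ← Finset.sum_add_distrib]
  refine Finset.sum_le_sum fun ω _ => ?_
  have hnn : 0 ≤ ∑ x ∈ (L (Y ω)).erase (X ω), (if f x = f (X ω) then (1 : ℝ) else 0) :=
    Finset.sum_nonneg fun x _ => by split_ifs <;> norm_num
  by_cases hX : X ω ∈ L (Y ω)
  · have hex : ∃ x ∈ L (Y ω), f x = f (X ω) := ⟨X ω, hX, rfl⟩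
    beta_reduce
    rw [dif_pos hex]
    have hXn : ¬ (τ * pr p (fun ω => (X ω, Y ω)) (X ω, Y ω) < pr p Y (Y ω)) :=
      not_lt.2 (Finset.mem_filter.1 hX).2
    rw [if_neg hXn, zero_add]
    split_ifs with hne
    · refine le_mul_of_one_le_right (hp.1 ω) ?_
      have hmem : hex.choose ∈ (L (Y ω)).erase (X ω) :=
        Finset.mem_erase.2 ⟨hne, hex.choose_spec.1⟩
      have := Finset.single_le_sum (f := fun x => if f x = f (X ω) then (1 : ℝ) else 0)
        (fun x _ => by split_ifs <;> norm_num) hmem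
      rwa [if_pos hex.choose_spec.2] at this
    · exact mul_nonneg (hp.1 ω) hnn
  · have hXn : τ * pr p (fun ω => (X ω, Y ω)) (X ω, Y ω) < pr p Y (Y ω) := by
      by_contra hc
      exact hX (Finset.mem_filter.2 ⟨Finset.mem_univ _, not_lt.1 hc⟩)
    rw [if_pos hXn]
    have := mul_nonneg (hp.1 ω) hnn
    have := hp.1 ω
    split_ifs <;> linarith

lemma exists_codebook_size {h δ ε : ℝ} (hh : 0 ≤ h) (hδ : 0 < δ) (hε : 0 < ε) :
    ∃ N₀ : ℕ, ∀ N ≥ N₀, ∃ M : ℕ, 0 < M ∧ Real.logb 2 M ≤ N * (h + 3 * δ) ∧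
      (2 : ℝ) ^ (N * (h + δ)) / M ≤ ε := by
  have ht : Filter.Tendsto (fun N : ℕ => ((2 : ℝ) ^ (-δ)) ^ N) Filter.atTop (nhds 0) :=
    tendsto_pow_atTop_nhds_zero_of_lt_one (by positivity)
      (Real.rpow_lt_one_of_one_lt_of_neg (by norm_num) (by linarith))
  obtain ⟨N₁, hN₁⟩ := Filter.eventually_atTop.1 (ht.eventually (ge_mem_nhds hε))
  obtain ⟨N₂, hN₂⟩ := exists_nat_gt (1 / δ)
  refine ⟨max N₁ N₂, fun N hN => ?_⟩
  have hN2 : 1 ≤ N * δ := by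
    have : (N₂ : ℝ) ≤ N := by exact_mod_cast (le_max_right _ _).trans hN
    rw [div_lt_iff₀ hδ] at hN₂
    nlinarith
  have h1 : (1 : ℝ) ≤ 2 ^ (N * (h + 2 * δ)) := Real.one_le_rpow (by norm_num) (by positivity)
  have hpos : 0 < ⌈(2 : ℝ) ^ (N * (h + 2 * δ))⌉₊ := Nat.ceil_pos.2 (by positivity)
  refine ⟨⌈(2 : ℝ) ^ (N * (h + 2 * δ))⌉₊, hpos, ?_, ?_⟩
  · have h2 : ((⌈(2 : ℝ) ^ (N * (h + 2 * δ))⌉₊ : ℕ) : ℝ) ≤ 2 ^ (1 + N * (h + 2 * δ)) := by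
      rw [Real.rpow_add (by norm_num), Real.rpow_one]
      have := Nat.ceil_lt_add_one (a := (2 : ℝ) ^ (N * (h + 2 * δ))) (by positivity)
      linarith
    rw [Real.logb_le_iff_le_rpow (by norm_num) (by exact_mod_cast hpos)]
    refine h2.trans (Real.rpow_le_rpow_of_exponent_le (by norm_num) ?_)
    linarith
  · refine le_trans ?_ (hN₁ N ((le_max_left _ _).trans hN))
    rw [div_le_iff₀ (by exact_mod_cast hpos)]
    refine le_trans (le_of_eq ?_) (mul_le_mul_of_nonneg_left (Nat.le_ceil _) (by positivity))
    rw [← Real.rpow_natCast, ← Real.rpow_mul (by norm_num), ← Real.rpow_add (by norm_num)]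
    congr 1
    ring

/-- Block source coding with side information at the decoder, at any rate above the conditional
entropy. -/
lemma exists_binning [Nonempty 𝒳] {p : Ω → ℝ} (hp : IsPMF p) (X : Ω → 𝒳) (Y : Ω → 𝒴) {ε : ℝ}
    (hε : 0 < ε) :
    ∃ N₀ : ℕ, ∀ N ≥ N₀, ∃ (M : ℕ) (f : (Fin N → 𝒳) → Fin M)
      (g : Fin M → (Fin N → 𝒴) → (Fin N → 𝒳)), 0 < M ∧
      Real.logb 2 M ≤ N * (Hc p X Y + ε) ∧
      prE (blk N p) (fun ω => g (f fun i => X (ω i)) (fun i => Y (ω i)) ≠ fun i => X (ω i)) ≤ ε := by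
  set F : Ω → ℝ := fun ω =>
    -Real.logb 2 (pr p (fun ω => (X ω, Y ω)) (X ω, Y ω) / pr p Y (Y ω)) with hF
  have hm : ∑ ω, p ω * F ω = Hc p X Y := (Hc_eq hp.1 X Y).symm
  obtain ⟨N₁, hN₁⟩ := exists_codebook_size (Hc_nonneg hp.1 X Y) (δ := ε / 3) (ε := ε / 2)
    (by positivity) (by positivity)
  obtain ⟨N₂, hN₂⟩ := exists_prE_blk_le hp F (δ := ε / 3) (ε := ε / 2) (by positivity)
    (by positivity)
  refine ⟨max N₁ N₂, fun N hN => ?_⟩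
  obtain ⟨M, hM, hM1, hM2⟩ := hN₁ N ((le_max_left _ _).trans hN)
  obtain ⟨f, g, hfg⟩ := exists_binning_oneshot (isPMF_blk hp N) (fun ω i => X (ω i))
    (fun ω i => Y (ω i)) hM (τ := 2 ^ (N * (Hc p X Y + ε / 3))) (by positivity)
  refine ⟨M, f, g, hM, hM1.trans (le_of_eq (by ring)), hfg.trans ?_⟩
  have h2 := hN₂ N ((le_max_right _ _).trans hN)
  rw [hm] at h2
  refine (add_le_add (le_trans (prE_mono (isPMF_blk hp N).1 ?_) h2) hM2).trans (by linarith)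
  intro ω h0 h
  have hpi : ∀ i, 0 < p (ω i) := fun i => (hp.1 _).lt_of_ne' fun hz =>
    h0.ne' (Finset.prod_eq_zero (Finset.mem_univ i) hz)
  have hxy : ∀ i, 0 < pr p (fun ω => (X ω, Y ω)) (X (ω i), Y (ω i)) := fun i =>
    (hpi i).trans_le (le_pr hp.1 (fun ω => (X ω, Y ω)) _)
  have hy : ∀ i, 0 < pr p Y (Y (ω i)) := fun i => (hpi i).trans_le (le_pr hp.1 Y _)
  have e1 : pr (blk N p) (fun ω => ((fun i => X (ω i)), fun i => Y (ω i)))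
      (fun i => X (ω i), fun i => Y (ω i)) =
      ∏ i, pr p (fun ω => (X ω, Y ω)) (X (ω i), Y (ω i)) := by
    rw [← pr_blk N p (fun ω => (X ω, Y ω)) (fun i => (X (ω i), Y (ω i)))]
    refine pr_congr_iff _ fun ω' => ?_
    simp only [Prod.ext_iff, funext_iff]
    exact forall_and.symm
  rw [e1, pr_blk] at h
  have e2 : ∑ i, F (ω i) = Real.logb 2 ((∏ i, pr p Y (Y (ω i))) /
      ∏ i, pr p (fun ω => (X ω, Y ω)) (X (ω i), Y (ω i))) := by
    rw [← Finset.prod_div_distrib, Real.logb_prod _ _ fun i _ => (div_pos (hy i) (hxy i)).ne']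
    refine Finset.sum_congr rfl fun i _ => ?_
    rw [hF]
    beta_reduce
    rw [← Real.logb_inv, inv_div]
  rw [e2, Real.lt_logb_iff_rpow_lt (by norm_num)
    (div_pos (Finset.prod_pos fun i _ => hy i) (Finset.prod_pos fun i _ => hxy i)),
    lt_div_iff₀ (Finset.prod_pos fun i _ => hxy i)]
  exact h

end Binning

section DeterministicAuxiliaries

variable {Ω 𝒳 𝒵 ℰ 𝒰 𝒱 : Type*} [Fintype Ω] [Fintype 𝒳] [Fintype 𝒵] [Fintype ℰ] [Fintype 𝒰]
  [Fintype 𝒱]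

lemma H_blk_pair {p : Ω → ℝ} (hp : IsPMF p) (N : ℕ) (X : Ω → 𝒳) (Y : Ω → 𝒵) :
    H (blk N p) (fun ω => ((fun i => X (ω i)), fun i => Y (ω i))) =
      N * H p (fun ω => (X ω, Y ω)) := by
  rw [← H_blk hp]
  refine H_congr_iff _ fun ω ω' => ?_
  simp only [Prod.ext_iff, funext_iff]
  exact forall_and.symm

/-- Revealing bins of `ψ(X)` together with `M` bins of `X` leaves an equivocation of at least
`H(X | ψ(X), E) - log M`. -/
lemma equivocation_bins {𝒥 : Type*} [Fintype 𝒥] {M : ℕ} (hM : 0 < M) {p : Ω → ℝ} (hp : IsPMF p)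
    (X : Ω → 𝒳) (E : Ω → ℰ) (ψ : 𝒳 → 𝒰) (f₁ : 𝒰 → 𝒥) (f₂ : 𝒳 → Fin M) :
    H p (fun ω => (X ω, E ω)) - H p (fun ω => (ψ (X ω), E ω)) - Real.logb 2 M ≤
      Hc p X (fun ω => ((f₁ (ψ (X ω)), f₂ (X ω)), E ω)) := by
  have : Nonempty (Fin M) := ⟨⟨0, hM⟩⟩
  have h1 : H p (fun ω => (X ω, ((f₁ (ψ (X ω)), f₂ (X ω)), E ω))) =
      H p (fun ω => (X ω, E ω)) := by
    refine H_congr_iff p fun ω ω' => ?_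
    simp only [Prod.ext_iff]
    constructor
    · tauto
    · rintro ⟨h, h'⟩
      simp [h, h']
  have h2 : H p (fun ω => ((f₁ (ψ (X ω)), f₂ (X ω)), E ω)) ≤
      H p (fun ω => (f₂ (X ω), (ψ (X ω), E ω))) := by
    refine H_le_of_fun hp.1 fun ω ω' h => ?_
    simp only [Prod.ext_iff] at h ⊢
    simp [h]
  have h3 := Hc_le_logb_card hp (fun ω => f₂ (X ω)) (fun ω => (ψ (X ω), E ω))
  rw [Fintype.card_fin] at h3
  unfold Hc at h3 ⊢
  rw [h1]
  linarith

/-- Achievability for auxiliary random variables that are functions of the sources. -/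
lemma exists_blockCode [Nonempty 𝒳] [Nonempty 𝒵] {p : Ω → ℝ} (hp : IsPMF p) (X : Ω → 𝒳)
    (Z : Ω → 𝒵) (E : Ω → ℰ) (ψ : 𝒳 → 𝒰) (φ : 𝒵 → 𝒱) {ε : ℝ} (hε : 0 < ε) :
    ∃ N₀ : ℕ, ∀ N ≥ N₀, BlockCode N p X Z E
      (N * (Hc p X (fun ω => φ (Z ω)) + ε))
      (N * (H p (fun ω => φ (Z ω)) + Hc p Z (fun ω => (X ω, φ (Z ω))) + ε))
      (N * (H p (fun ω => (X ω, E ω)) - H p (fun ω => (ψ (X ω), E ω)) -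
        Hc p X (fun ω => (ψ (X ω), φ (Z ω))) - ε)) ε := by
  have : Nonempty 𝒰 := ‹Nonempty 𝒳›.map ψ
  have : Nonempty 𝒱 := ‹Nonempty 𝒵›.map φ
  have hε4 : 0 < ε / 4 := by positivity
  obtain ⟨n₁, h₁⟩ := exists_binning hp (fun ω => ψ (X ω)) (fun ω => φ (Z ω)) hε4
  obtain ⟨n₂, h₂⟩ := exists_binning hp X (fun ω => (ψ (X ω), φ (Z ω))) hε4
  obtain ⟨n₃, h₃⟩ := exists_binning hp (fun ω => φ (Z ω)) (fun _ => ()) hε4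
  obtain ⟨n₄, h₄⟩ := exists_binning hp Z (fun ω => (X ω, φ (Z ω))) hε4
  refine ⟨max (max n₁ n₂) (max n₃ n₄), fun N hN => ?_⟩
  simp only [ge_iff_le, max_le_iff] at hN
  obtain ⟨M₁, f₁, g₁, hM₁, hl₁, he₁⟩ := h₁ N hN.1.1
  obtain ⟨M₂, f₂, g₂, hM₂, hl₂, he₂⟩ := h₂ N hN.1.2
  obtain ⟨M₃, f₃, g₃, hM₃, hl₃, he₃⟩ := h₃ N hN.2.1
  obtain ⟨M₄, f₄, g₄, hM₄, hl₄, he₄⟩ := h₄ N hN.2.2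
  have : Nonempty (Fin M₁) := ⟨⟨0, hM₁⟩⟩
  have : Nonempty (Fin M₂) := ⟨⟨0, hM₂⟩⟩
  have : Nonempty (Fin M₃) := ⟨⟨0, hM₃⟩⟩
  have : Nonempty (Fin M₄) := ⟨⟨0, hM₄⟩⟩
  have hlog : ∀ {m n : ℕ}, 0 < m → 0 < n → Real.logb 2 ((m * n : ℕ) : ℝ) =
      Real.logb 2 m + Real.logb 2 n := fun hm hn => by
    push_cast
    exact Real.logb_mul (by positivity) (by positivity)
  have hb := isPMF_blk hp N
  have hNε : 0 ≤ N * ε := by positivity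
  rw [← H_eq_Hc_unit hp] at hl₃
  refine Code.of_types (μ := Fin M₁ × Fin M₂) (ν := Fin M₃ × Fin M₄)
    (fun x => (f₁ fun i => ψ (x i), f₂ x)) (fun z => (f₃ fun i => φ (z i), f₄ z))
    (fun j k =>
      let v := g₃ k.1 fun _ => ()
      let u := g₁ j.1 v
      let x := g₂ j.2 fun i => (u i, v i)
      (x, g₄ k.2 fun i => (x i, v i))) ?_ ?_ ?_ ?_
  · rw [Fintype.card_prod, Fintype.card_fin, Fintype.card_fin, hlog hM₁ hM₂]
    refine (add_le_add hl₁ hl₂).trans ?_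
    have : H p (fun ω => (X ω, (ψ (X ω), φ (Z ω)))) = H p (fun ω => (X ω, φ (Z ω))) := by
      refine H_congr_iff p fun ω ω' => ?_
      simp only [Prod.ext_iff]
      constructor
      · tauto
      · rintro ⟨h, h'⟩
        simp [h, h']
    simp only [Hc, this]
    linarith
  · rw [Fintype.card_prod, Fintype.card_fin, Fintype.card_fin, hlog hM₃ hM₄]
    refine (add_le_add hl₃ hl₄).trans ?_
    linarith
  · refine le_trans ?_ (equivocation_bins hM₂ hb (fun ω i => X (ω i)) (fun ω i => E (ω i))
      (fun x i => ψ (x i)) f₁ f₂)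
    rw [H_blk_pair hp N X E, H_blk_pair hp N (fun ω => ψ (X ω)) E]
    linarith
  · refine le_trans ?_ (show ε / 4 + ε / 4 + (ε / 4 + ε / 4) ≤ ε by linarith)
    refine le_trans ?_ (add_le_add (add_le_add he₁ he₂) (add_le_add he₃ he₄))
    refine le_trans ?_ (add_le_add (prE_or_le hb.1 _ _) (prE_or_le hb.1 _ _))
    refine le_trans (prE_mono hb.1 ?_) (prE_or_le hb.1 _ _)
    intro ω _ h
    by_contra! hc
    obtain ⟨⟨c₁, c₂⟩, c₃, c₄⟩ := hc
    apply h
    simp only [c₃, c₁, c₂, c₄]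

end DeterministicAuxiliaries

section Asymptotic

variable {S 𝒳 𝒵 ℰ : Type*} [Fintype S] [Fintype 𝒳] [Fintype 𝒵] [Fintype ℰ]

/-- The triple `r` is achieved by codes of every sufficiently large block length. -/
def EventuallyAchievable (p : S → ℝ) (X : S → 𝒳) (Z : S → 𝒵) (E : S → ℰ) (r : ℝ × ℝ × ℝ) : Prop :=
  ∀ ε : ℝ, 0 < ε → ∃ N₀ : ℕ, ∀ N ≥ N₀,
    BlockCode N p X Z E (N * (r.1 + ε)) (N * (r.2.1 + ε)) (N * (r.2.2 - ε)) ε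

variable {p : S → ℝ} {X : S → 𝒳} {Z : S → 𝒵} {E : S → ℰ}

lemma EventuallyAchievable.of_approx {r : ℝ × ℝ × ℝ}
    (h : ∀ ε : ℝ, 0 < ε → ∃ r' : ℝ × ℝ × ℝ, EventuallyAchievable p X Z E r' ∧
      r'.1 ≤ r.1 + ε ∧ r'.2.1 ≤ r.2.1 + ε ∧ r.2.2 - ε ≤ r'.2.2) :
    EventuallyAchievable p X Z E r := by
  intro ε hε
  obtain ⟨r', hr', h1, h2, h3⟩ := h (ε / 2) (by positivity)
  obtain ⟨N₀, hN₀⟩ := hr' (ε / 2) (by positivity)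
  refine ⟨N₀, fun N hN => (hN₀ N hN).mono ?_ ?_ ?_ (by linarith)⟩ <;>
  exact mul_le_mul_of_nonneg_left (by linarith) (by positivity)

/-- The equivocation is never negative. -/
lemma EventuallyAchievable.max_zero {a c d : ℝ} (hp : IsPMF p)
    (h : EventuallyAchievable p X Z E (a, c, d)) :
    EventuallyAchievable p X Z E (a, c, max d 0) := by
  intro ε hε
  obtain ⟨N₀, hN₀⟩ := h ε hε
  refine ⟨N₀, fun N hN => ?_⟩
  obtain ⟨MA, MC, h1, h2, fA, fC, g, h3, h4, h5, h6⟩ := hN₀ N hN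
  refine ⟨MA, MC, h1, h2, fA, fC, g, h3, h4, ?_, h6⟩
  rcases max_cases d 0 with ⟨hm, -⟩ | ⟨hm, -⟩ <;> simp only [hm]
  · exact h5
  · refine le_trans ?_ (Hc_nonneg (isPMF_blk hp N).1 _ _)
    have : 0 ≤ N * ε := by positivity
    linarith

/-- Time sharing. -/
lemma convex_eventuallyAchievable (hp : IsPMF p) :
    Convex ℝ {r | EventuallyAchievable p X Z E r} := by
  rw [convex_iff_forall_pos]
  rintro x hx y hy a b ha hb hab ε hε
  obtain ⟨n₁, h₁⟩ := hx (ε / 2) (by positivity)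
  obtain ⟨n₂, h₂⟩ := hy (ε / 2) (by positivity)
  set D := |x.1 - y.1| + |x.2.1 - y.2.1| + |x.2.2 - y.2.2| with hD
  obtain ⟨k, hk⟩ := exists_nat_gt (max ((n₁ + 1) / a) (max (n₂ / b) (D / (ε / 2))))
  simp only [max_lt_iff] at hk
  obtain ⟨hk1, hk2, hk3⟩ := hk
  rw [div_lt_iff₀ (by positivity)] at hk1 hk2 hk3
  refine ⟨k, fun N hN => ?_⟩
  have hkN : (k : ℝ) ≤ N := by exact_mod_cast hN
  obtain ⟨m, hm1, hm2⟩ : ∃ m : ℕ, (m : ℝ) ≤ a * N ∧ a * N < m + 1 :=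
    ⟨⌊a * N⌋₊, Nat.floor_le (by positivity), Nat.lt_floor_add_one _⟩
  have hmN : m ≤ N := by
    have : (m : ℝ) ≤ N := hm1.trans (mul_le_of_le_one_left (by positivity) (by linarith))
    exact_mod_cast this
  obtain ⟨n, rfl⟩ := Nat.exists_eq_add_of_le hmN
  push_cast at hm1 hm2 hkN
  have e1 : (n₁ : ℝ) ≤ m := by nlinarith
  have e2 : (n₂ : ℝ) ≤ n := by nlinarith
  have c1 := h₁ m (by exact_mod_cast e1)
  have c2 := h₂ n (by exact_mod_cast e2)
  have hDk : D ≤ (m + n) * (ε / 2) := by nlinarith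
  have habs : |(m : ℝ) - a * (m + n)| ≤ 1 := by rw [abs_le]; constructor <;> linarith
  have hb' : b = 1 - a := by linarith
  have hslack : ∀ s t : ℝ, |(m : ℝ) * s + n * t - (m + n) * (a * s + b * t)| ≤ |s - t| := by
    intro s t
    have : (m : ℝ) * s + n * t - (m + n) * (a * s + b * t) = (m - a * (m + n)) * (s - t) := by
      rw [hb']; ring
    rw [this, abs_mul]
    exact mul_le_of_le_one_left (abs_nonneg _) habs
  have s1 := abs_le.1 (hslack x.1 y.1)
  have s2 := abs_le.1 (hslack x.2.1 y.2.1)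
  have s3 := abs_le.1 (hslack x.2.2 y.2.2)
  have a1 := abs_nonneg (x.1 - y.1)
  have a2 := abs_nonneg (x.2.1 - y.2.1)
  have a3 := abs_nonneg (x.2.2 - y.2.2)
  refine (BlockCode.append hp c1 c2).mono ?_ ?_ ?_ (by linarith) <;>
  simp only [Prod.fst_add, Prod.snd_add, Prod.smul_fst, Prod.smul_snd, smul_eq_mul] <;>
  push_cast <;> linarith

/-- Achievability for auxiliary random variables that are functions of source blocks. -/
lemma eventuallyAchievable_of_blocks [Nonempty 𝒳] [Nonempty 𝒵] (hp : IsPMF p) {n : ℕ}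
    (hn : 0 < n) {𝒰 𝒱 : Type*} [Fintype 𝒰] [Fintype 𝒱] (ψ : (Fin n → 𝒳) → 𝒰)
    (φ : (Fin n → 𝒵) → 𝒱) :
    EventuallyAchievable p X Z E
      (Hc (blk n p) (fun ω i => X (ω i)) (fun ω => φ fun i => Z (ω i)) / n,
        (H (blk n p) (fun ω => φ fun i => Z (ω i)) +
          Hc (blk n p) (fun ω i => Z (ω i)) (fun ω => (fun i => X (ω i), φ fun i => Z (ω i)))) / n,
        (H (blk n p) (fun ω => (fun i => X (ω i), fun i => E (ω i))) -
          H (blk n p) (fun ω => (ψ fun i => X (ω i), fun i => E (ω i))) -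
          Hc (blk n p) (fun ω i => X (ω i))
            (fun ω => (ψ fun i => X (ω i), φ fun i => Z (ω i)))) / n) := by
  intro ε hε
  obtain ⟨N₀, hN₀⟩ := exists_blockCode (isPMF_blk hp n) (fun ω i => X (ω i))
    (fun ω i => Z (ω i)) (fun ω i => E (ω i)) ψ φ (half_pos hε)
  set ra := Hc (blk n p) (fun ω i => X (ω i)) (fun ω => φ fun i => Z (ω i))
  set rc := H (blk n p) (fun ω => φ fun i => Z (ω i)) +
          Hc (blk n p) (fun ω i => Z (ω i)) (fun ω => (fun i => X (ω i), φ fun i => Z (ω i)))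
  set rd := H (blk n p) (fun ω => (fun i => X (ω i), fun i => E (ω i))) -
          H (blk n p) (fun ω => (ψ fun i => X (ω i), fun i => E (ω i))) -
          Hc (blk n p) (fun ω i => X (ω i))
            (fun ω => (ψ fun i => X (ω i), φ fun i => Z (ω i)))
  have hn' : (0 : ℝ) < n := by exact_mod_cast hn
  have hn1 : (1 : ℝ) ≤ n := by exact_mod_cast hn
  set la := Real.logb 2 (Fintype.card 𝒳)
  set lc := Real.logb 2 (Fintype.card 𝒵)
  obtain ⟨k, hk⟩ := exists_nat_gt ((|ra| + |rc| + |rd| + n * |la| + n * |lc|) / (ε / 2))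
  rw [div_lt_iff₀ (by positivity)] at hk
  refine ⟨max k (n * N₀), fun N hN => ?_⟩
  have hkN : (k : ℝ) ≤ N := by exact_mod_cast (le_max_left _ _).trans hN
  have hq : N₀ ≤ N / n := (Nat.le_div_iff_mul_le hn).2 (by
    rw [mul_comm]; exact (le_max_right _ _).trans hN)
  have hdiv : N / n * n + N % n = N := by rw [mul_comm]; exact Nat.div_add_mod N n
  have hrn : N % n < n := Nat.mod_lt _ hn
  have c1 := BlockCode.flatten (hN₀ (N / n) hq)
  have c2 := BlockCode.uncoded hp (N % n) X Z E
  have c3 := BlockCode.append hp c1 c2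
  rw [hdiv] at c3
  set q := N / n
  set r := N % n
  have hN' : (N : ℝ) = q * n + r := by exact_mod_cast hdiv.symm
  have hr' : (r : ℝ) ≤ n := by exact_mod_cast hrn.le
  have hr0 : (0 : ℝ) ≤ r := by positivity
  have hq0 : (0 : ℝ) ≤ q := by positivity
  have hqN : (q : ℝ) ≤ N := by rw [hN']; nlinarith
  have key : ∀ s : ℝ, |N * (s / n) - q * s| ≤ |s| := by
    intro s
    have : N * (s / n) - q * s = (r / n) * s := by
      rw [hN']; field_simp; ring
    rw [this, abs_mul]
    refine mul_le_of_le_one_left (abs_nonneg _) ?_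
    rw [abs_of_nonneg (by positivity), div_le_one hn']
    exact hr'
  have ka := abs_le.1 (key ra)
  have kc := abs_le.1 (key rc)
  have kd := abs_le.1 (key rd)
  have hla : r * la ≤ n * |la| :=
    (mul_le_mul_of_nonneg_left (le_abs_self _) hr0).trans
      (mul_le_mul_of_nonneg_right hr' (abs_nonneg _))
  have hlc : r * lc ≤ n * |lc| :=
    (mul_le_mul_of_nonneg_left (le_abs_self _) hr0).trans
      (mul_le_mul_of_nonneg_right hr' (abs_nonneg _))
  have hqe : q * (ε / 2) ≤ N * (ε / 2) := mul_le_mul_of_nonneg_right hqN (by positivity)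
  have hke : k * (ε / 2) ≤ N * (ε / 2) := mul_le_mul_of_nonneg_right hkN (by positivity)
  have b1 := abs_nonneg ra
  have b2 := abs_nonneg rc
  have b3 := abs_nonneg rd
  have b4 := mul_nonneg hn'.le (abs_nonneg la)
  have b5 := mul_nonneg hn'.le (abs_nonneg lc)
  exact c3.mono (by linarith) (by linarith) (by linarith) (by linarith)

end Asymptotic

section Covering

/-- A random codebook with i.i.d. `q` entries carries, on average, a pmf `W` whose density with
respect to `q` is mostly below `L`, as soon as its size exceeds `L`. -/
lemma exists_codebook_pmf {𝒴 : Type*} [Fintype 𝒴] [DecidableEq 𝒴] {q W : 𝒴 → ℝ} (hq : IsPMF q)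
    (hW : IsPMF W) {K : ℕ} (hK : 0 < K) {L η : ℝ} (hL : 0 < L) (hη : 0 < η) :
    ∃ Q : (Fin K → 𝒴) → 𝒴 → ℝ, (∀ y, IsPMF (Q y)) ∧ (∀ b, ∑ y, blk K q y * Q y b = W b) ∧
      ∑ y, blk K q y * ∑ b, (if ∃ k, y k = b then 0 else Q y b) ≤
        prE W (fun b => L * q b < W b) + η + L / (K * η) := by
  have hK' : (0 : ℝ) < K := by exact_mod_cast hK
  have hm := isPMF_blk hq K
  set G : 𝒴 → ℝ := fun b => if L * q b < W b then 0 else W b with hG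
  have hG0 : ∀ b, 0 ≤ G b := fun b => by
    simp only [hG]; split_ifs; exacts [le_rfl, hW.1 b]
  have hGW : ∀ b, G b ≤ W b := fun b => by
    simp only [hG]; split_ifs; exacts [hW.1 b, le_rfl]
  have hGL : ∀ b, G b ≤ L * q b := fun b => by
    simp only [hG]; split_ifs with h; exacts [mul_nonneg hL.le (hq.1 b), not_lt.1 h]
  set d : 𝒴 → ℝ := fun b => G b / q b with hd
  have hd0 : ∀ b, 0 ≤ d b := fun b => div_nonneg (hG0 b) (hq.1 b)
  have hdL : ∀ b, d b ≤ L := fun b => div_le_of_le_mul₀ (hq.1 b) hL.le (hGL b)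
  have hqd : ∀ b, q b * d b = G b := fun b => by
    rcases eq_or_ne (q b) 0 with h | h
    · have h1 := hGL b
      rw [h, mul_zero] at h1
      rw [h, zero_mul, le_antisymm h1 (hG0 b)]
    · rw [hd]; field_simp
  set g := ∑ b, G b with hg
  have hg1 : 1 - g = prE W (fun b => L * q b < W b) := by
    rw [hg, ← hW.2, ← Finset.sum_sub_distrib]
    unfold prE
    refine Finset.sum_congr rfl fun b _ => ?_
    simp only [hG]
    split_ifs <;> ring
  have hg1' : 0 ≤ 1 - g := hg1 ▸ prE_nonneg hW.1 _
  set z : (Fin K → 𝒴) → ℝ := fun y => (∑ k, d (y k)) / K with hz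
  have hz0 : ∀ y, 0 ≤ z y := fun y =>
    div_nonneg (Finset.sum_nonneg fun k _ => hd0 _) hK'.le
  set Q : (Fin K → 𝒴) → 𝒴 → ℝ := fun y b =>
    (∑ k, if y k = b then d b else 0) / K / max 1 (z y) with hQ
  have hmax : ∀ y, 0 < max 1 (z y) := fun y => lt_max_of_lt_left one_pos
  have hQn : ∀ (y : Fin K → 𝒴) (b : 𝒴), 0 ≤ (∑ k, if y k = b then d b else 0) / (K : ℝ) := fun y b =>
    div_nonneg (Finset.sum_nonneg fun k _ => by split_ifs; exacts [hd0 b, le_rfl]) hK'.le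
  have hQ0 : ∀ y b, 0 ≤ Q y b := fun y b => div_nonneg (hQn y b) (hmax y).le
  have hT : ∀ y, ∑ b, Q y b = z y / max 1 (z y) := fun y => by
    simp only [hQ, hz]
    rw [← Finset.sum_div, ← Finset.sum_div, Finset.sum_comm]
    simp
  have hT1 : ∀ y, 0 ≤ 1 - ∑ b, Q y b := fun y => by
    rw [hT, sub_nonneg, div_le_one (hmax y)]; exact le_max_right _ _
  have hEQ : ∀ b, ∑ y, blk K q y * Q y b ≤ W b := fun b => by
    calc ∑ y, blk K q y * Q y b
        ≤ ∑ y, blk K q y * ∑ k, (if y k = b then d b else 0) / K := by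
          refine Finset.sum_le_sum fun y _ => mul_le_mul_of_nonneg_left ?_ (hm.1 y)
          rw [← Finset.sum_div]
          exact div_le_self (hQn y b) (le_max_left _ _)
      _ = K * ∑ s, q s * ((if s = b then d b else 0) / K) :=
          sum_blk_sum hq K fun s => (if s = b then d b else 0) / K
      _ = G b := by
          rw [← hqd b]
          simp only [ite_div, zero_div, mul_ite, mul_zero, Finset.sum_ite_eq', Finset.mem_univ,
            if_true]
          field_simp
      _ ≤ W b := hGW b
  set R : 𝒴 → ℝ := fun b => W b - ∑ y, blk K q y * Q y b with hR
  have hR0 : ∀ b, 0 ≤ R b := fun b => sub_nonneg.2 (hEQ b)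
  set ρ := ∑ b, R b with hρ
  have hρ1 : ρ = ∑ y, blk K q y * (1 - ∑ b, Q y b) := by
    simp_rw [mul_sub, mul_one]
    rw [Finset.sum_sub_distrib, hm.2, hρ]
    simp only [hR]
    rw [Finset.sum_sub_distrib, hW.2, Finset.sum_comm]
    simp_rw [Finset.mul_sum]
  obtain ⟨R', hR', hRR⟩ : ∃ R' : 𝒴 → ℝ, IsPMF R' ∧ ∀ b, ρ * R' b = R b := by
    rcases eq_or_ne ρ 0 with h | h
    · refine ⟨W, hW, fun b => ?_⟩
      rw [h, zero_mul]
      exact ((Finset.sum_eq_zero_iff_of_nonneg fun b _ => hR0 b).1 (hρ ▸ h) b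
        (Finset.mem_univ b)).symm
    · refine ⟨fun b => R b / ρ, ⟨fun b => div_nonneg (hR0 b) (Finset.sum_nonneg fun b _ => hR0 b),
        ?_⟩, fun b => by field_simp⟩
      rw [← Finset.sum_div]
      exact div_self h
  refine ⟨fun y b => Q y b + (1 - ∑ b, Q y b) * R' b, fun y => ⟨fun b =>
    add_nonneg (hQ0 y b) (mul_nonneg (hT1 y) (hR'.1 b)), ?_⟩, fun b => ?_, ?_⟩
  · rw [Finset.sum_add_distrib, ← Finset.mul_sum, hR'.2]
    ring
  · simp_rw [mul_add, ← mul_assoc]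
    rw [Finset.sum_add_distrib, ← Finset.sum_mul, ← hρ1, hRR]
    simp only [hR]
    ring
  · have hv : ∑ y, blk K q y * (∑ k, (d (y k) - g)) ^ 2 ≤ K * L := by
      have h0 : ∑ s, q s * (d s - g) = 0 := by
        simp_rw [mul_sub, hqd]
        rw [Finset.sum_sub_distrib, ← Finset.sum_mul, hq.2]
        ring
      have h1 := sum_prod_mul_sq (ι := Fin K) hq h0
      rw [Fintype.card_fin] at h1
      unfold blk
      rw [h1]
      refine mul_le_mul_of_nonneg_left ?_ hK'.le
      have h2 : ∑ s, q s * (d s - g) ^ 2 = ∑ s, G s * d s - g ^ 2 := by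
        have : ∀ s, q s * (d s - g) ^ 2 = G s * d s - 2 * g * G s + q s * g ^ 2 := fun s => by
          rw [← hqd s]; ring
        simp_rw [this]
        rw [Finset.sum_add_distrib, Finset.sum_sub_distrib, ← Finset.mul_sum, ← Finset.sum_mul,
          hq.2, ← hg]
        ring
      have h3 : ∑ s, G s * d s ≤ ∑ s, G s * L :=
        Finset.sum_le_sum fun s _ => mul_le_mul_of_nonneg_left (hdL s) (hG0 s)
      rw [← Finset.sum_mul, ← hg] at h3
      nlinarith [sq_nonneg g]
    have hpt : ∀ y, ∑ b, (if ∃ k, y k = b then 0 else Q y b + (1 - ∑ b, Q y b) * R' b) ≤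
        (1 - g) + η + (∑ k, (d (y k) - g)) ^ 2 * (1 / (K ^ 2 * η)) := fun y => by
      have h1 : ∑ b, (if ∃ k, y k = b then 0 else Q y b + (1 - ∑ b, Q y b) * R' b) ≤
          ∑ b, (1 - ∑ b, Q y b) * R' b := by
        refine Finset.sum_le_sum fun b _ => ?_
        split_ifs with h
        · exact mul_nonneg (hT1 y) (hR'.1 b)
        · have : Q y b = 0 := by
            have h' : ∀ k, y k ≠ b := fun k hk => h ⟨k, hk⟩
            simp [hQ, h']
          rw [this, zero_add]
      rw [← Finset.mul_sum, hR'.2, mul_one] at h1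
      refine h1.trans ?_
      rw [hT]
      have h2 : (∑ k, (d (y k) - g)) ^ 2 * (1 / (K ^ 2 * η)) = (g - z y) ^ 2 / η := by
        rw [Finset.sum_sub_distrib]
        simp only [hz, Finset.sum_const, Finset.card_univ, Fintype.card_fin, nsmul_eq_mul]
        field_simp
        ring
      rw [h2]
      have h3 : g - z y ≤ η + (g - z y) ^ 2 / η := by
        rw [← sub_le_iff_le_add', le_div_iff₀ hη]
        nlinarith [sq_nonneg (g - z y - η), sq_nonneg (g - z y)]
      have h4 : 0 ≤ (g - z y) ^ 2 / η := by positivity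
      rcases le_total (z y) 1 with h | h
      · rw [max_eq_left h, div_one]; linarith
      · rw [max_eq_right h, div_self (by linarith)]; linarith
    refine (Finset.sum_le_sum fun y _ => mul_le_mul_of_nonneg_left (hpt y) (hm.1 y)).trans ?_
    simp_rw [mul_add, ← mul_assoc]
    rw [Finset.sum_add_distrib, Finset.sum_add_distrib, ← Finset.sum_mul, ← Finset.sum_mul,
      ← Finset.sum_mul, hm.2, hg1, one_mul, one_mul]
    gcongr
    refine (mul_le_mul_of_nonneg_right hv (by positivity)).trans (le_of_eq ?_)
    field_simp

/-- The entropy of a random map is small if its values lie in a small codebook with high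
probability. -/
lemma H_le_codebook {𝒳 𝒴 : Type*} [Fintype 𝒳] [Fintype 𝒴] [DecidableEq 𝒴] {P : 𝒳 → ℝ}
    (hP : IsPMF P) {K : ℕ} (hK : 0 < K) (y : Fin K → 𝒴) (s : 𝒳 → 𝒴) :
    H P s ≤ 1 + Real.logb 2 K +
      Real.logb 2 (Fintype.card 𝒴) * ∑ x, P x * if ∃ k, y k = s x then 0 else 1 := by
  have hK' : (0 : ℝ) < K := by exact_mod_cast hK
  have hK1 : (1 : ℝ) ≤ K := by exact_mod_cast hK
  have hY : 0 < Fintype.card 𝒴 := Fintype.card_pos_iff.2 ⟨y ⟨0, hK⟩⟩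
  have hY' : (0 : ℝ) < Fintype.card 𝒴 := by exact_mod_cast hY
  have hY1 : (1 : ℝ) ≤ Fintype.card 𝒴 := by exact_mod_cast hY
  have hlK := Real.logb_nonneg (b := 2) (by norm_num) hK1
  have hlY := Real.logb_nonneg (b := 2) (by norm_num) hY1
  set r : 𝒴 → ℝ := fun b =>
    (∑ k, if y k = b then (1 : ℝ) else 0) / (2 * K) + 1 / (2 * Fintype.card 𝒴) with hr
  have hN : ∀ b, 0 ≤ ∑ k, if y k = b then (1 : ℝ) else 0 := fun b =>
    Finset.sum_nonneg fun k _ => by split_ifs; exacts [zero_le_one, le_rfl]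
  have hr0 : ∀ b, 0 < r b := fun b => by
    have := hN b
    positivity
  have hr1 : ∑ b, r b = 1 := by
    simp only [hr]
    rw [Finset.sum_add_distrib, ← Finset.sum_div, Finset.sum_comm]
    simp only [Finset.sum_ite_eq, Finset.mem_univ, if_true, Finset.sum_const, Finset.card_univ,
      Fintype.card_fin, nsmul_eq_mul]
    field_simp
    norm_num
  refine (H_le_cross hP s r hr0 hr1.le).trans ?_
  have hpt : ∀ x, -Real.logb 2 (r (s x)) ≤ 1 + Real.logb 2 K +
      Real.logb 2 (Fintype.card 𝒴) * if ∃ k, y k = s x then 0 else 1 := fun x => by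
    have hlog : ∀ t : ℝ, 0 < t → 1 / (2 * t) ≤ r (s x) →
        -Real.logb 2 (r (s x)) ≤ 1 + Real.logb 2 t := fun t ht h => by
      have h1 := Real.logb_le_logb_of_le (b := 2) (by norm_num) (by positivity) h
      rw [one_div, Real.logb_inv, Real.logb_mul (by norm_num) ht.ne',
        Real.logb_self_eq_one (by norm_num)] at h1
      linarith
    split_ifs with h
    · rw [mul_zero, add_zero]
      refine hlog _ hK' ?_
      obtain ⟨k, hk⟩ := h
      have h1 : (1 : ℝ) ≤ ∑ k, if y k = s x then (1 : ℝ) else 0 := by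
        have := Finset.single_le_sum (f := fun k => if y k = s x then (1 : ℝ) else 0)
          (fun k _ => by split_ifs; exacts [zero_le_one, le_rfl]) (Finset.mem_univ k)
        simpa [hk] using this
      have h2 : (0 : ℝ) < 1 / (2 * Fintype.card 𝒴) := by positivity
      have h3 := div_le_div_of_nonneg_right h1 (by positivity : (0 : ℝ) ≤ 2 * K)
      simp only [hr]
      linarith
    · rw [mul_one]
      refine (hlog _ hY' ?_).trans (by linarith)
      have := div_nonneg (hN (s x)) (by positivity : (0 : ℝ) ≤ 2 * K)
      simp only [hr]
      linarith
  refine (Finset.sum_le_sum fun x _ => mul_le_mul_of_nonneg_left (hpt x) (hP.1 x)).trans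
    (le_of_eq ?_)
  simp_rw [mul_add (P _)]
  rw [Finset.sum_add_distrib, Finset.mul_sum]
  congr 1
  · rw [Finset.sum_add_distrib, ← Finset.sum_mul, ← Finset.sum_mul, hP.2, one_mul, one_mul]
  · exact Finset.sum_congr rfl fun x _ => by ring

/-- One-shot covering: a kernel is a mixture of functions of small average entropy. -/
lemma exists_covering_oneshot {𝒳 𝒴 : Type} [Fintype 𝒳] [Fintype 𝒴] {P : 𝒳 → ℝ} (hP : IsPMF P)
    {W : 𝒳 → 𝒴 → ℝ} (hW : IsKernel W) {q : 𝒴 → ℝ} (hq : IsPMF q) {K : ℕ} (hK : 0 < K)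
    {L η : ℝ} (hL : 0 < L) (hη : 0 < η) :
    ∃ (κ : Type) (_ : Fintype κ) (w : κ → ℝ) (s : κ → 𝒳 → 𝒴), IsPMF w ∧
      (∀ x b, pr w (fun k => s k x) b = W x b) ∧
      ∑ k, w k * H P (s k) ≤ 1 + Real.logb 2 K + Real.logb 2 (Fintype.card 𝒴) *
        (prE (fun xb : 𝒳 × 𝒴 => P xb.1 * W xb.1 xb.2) (fun xb => L * q xb.2 < W xb.1 xb.2) +
          η + L / (K * η)) := by
  classical
  choose Q hQ hQW hQb using fun x =>
    exists_codebook_pmf hq (W := W x) ⟨fun b => (hW x).1 b, (hW x).2⟩ hK hL hη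
  have hm := isPMF_blk hq K
  set w : (Fin K → 𝒴) × (𝒳 → 𝒴) → ℝ := fun ys => blk K q ys.1 * ∏ x, Q x ys.1 (ys.2 x) with hw
  have hQs : ∀ y, IsPMF (fun s : 𝒳 → 𝒴 => ∏ x, Q x y (s x)) := fun y =>
    isPMF_prod fun x => hQ x y
  have hwp : IsPMF w := ⟨fun ys => mul_nonneg (hm.1 _) ((hQs _).1 _), by
    rw [Fintype.sum_prod_type]
    simp only [hw]
    simp_rw [← Finset.mul_sum, (hQs _).2, mul_one]
    exact hm.2⟩
  have hsum : ∀ (x : 𝒳) (F : (Fin K → 𝒴) → 𝒴 → ℝ), ∑ ys, w ys * F ys.1 (ys.2 x) =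
      ∑ y, blk K q y * ∑ b, Q x y b * F y b := fun x F => by
    rw [Fintype.sum_prod_type]
    simp only [hw]
    refine Finset.sum_congr rfl fun y _ => ?_
    simp_rw [mul_assoc]
    rw [← Finset.mul_sum, sum_prod_mul (fun x => (hQ x y).2)]
  refine ⟨(Fin K → 𝒴) × (𝒳 → 𝒴), inferInstance, w, fun ys => ys.2, hwp, fun x b => ?_, ?_⟩
  · have h := hsum x (fun _ b' => if b' = b then 1 else 0)
    simp only [mul_ite, mul_one, mul_zero, Finset.sum_ite_eq', Finset.mem_univ, if_true] at h
    rw [hQW] at h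
    rw [← h]
    unfold pr
    refine Finset.sum_congr rfl fun ys _ => ?_
    congr
  · refine (Finset.sum_le_sum fun ys _ => mul_le_mul_of_nonneg_left
      (H_le_codebook hP hK ys.1 ys.2) (hwp.1 ys)).trans ?_
    simp_rw [mul_add (w _)]
    rw [Finset.sum_add_distrib, Finset.sum_add_distrib, ← Finset.sum_mul, ← Finset.sum_mul, hwp.2,
      one_mul, one_mul]
    gcongr
    have hY : 0 ≤ Real.logb 2 (Fintype.card 𝒴) := by
      rcases Nat.eq_zero_or_pos (Fintype.card 𝒴) with h | h
      · simp [h]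
      · exact Real.logb_nonneg (by norm_num) (by exact_mod_cast h)
    have h1 : ∑ ys, w ys * (Real.logb 2 (Fintype.card 𝒴) *
        ∑ x, P x * if ∃ k, ys.1 k = ys.2 x then 0 else 1) = Real.logb 2 (Fintype.card 𝒴) *
        ∑ x, P x * ∑ y, blk K q y * ∑ b, if ∃ k, y k = b then 0 else Q x y b := by
      simp_rw [mul_left_comm (w _)]
      rw [← Finset.mul_sum]
      congr 1
      simp_rw [Finset.mul_sum]
      rw [Finset.sum_comm]
      refine Finset.sum_congr rfl fun x _ => ?_
      simp_rw [mul_left_comm (w _)]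
      simp_rw [← Finset.mul_sum]
      rw [hsum x (fun y b => if ∃ k, y k = b then 0 else 1)]
      simp
    rw [h1]
    refine mul_le_mul_of_nonneg_left ?_ hY
    refine (Finset.sum_le_sum fun x _ => mul_le_mul_of_nonneg_left (hQb x) (hP.1 x)).trans
      (le_of_eq ?_)
    simp_rw [mul_add (P _)]
    rw [Finset.sum_add_distrib, Finset.sum_add_distrib, ← Finset.sum_mul, ← Finset.sum_mul, hP.2,
      one_mul, one_mul]
    congr 2
    unfold prE
    rw [Fintype.sum_prod_type]
    simp_rw [Finset.mul_sum, mul_ite, mul_zero]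

end Covering

section BlockCovering

lemma MI_nonneg {Ω α β : Type*} [Fintype Ω] [Fintype α] [Fintype β] {p : Ω → ℝ} (hp : IsPMF p)
    (X : Ω → α) (Y : Ω → β) : 0 ≤ MI p X Y := by
  have h := Hc_le_cross hp.1 X Y (fun x _ => pr p X x) (fun x _ => pr_nonneg hp.1 X x)
    (fun ω h => h.trans_le (le_pr hp.1 X ω)) (fun _ => by rw [sum_pr, hp.2])
  rw [← H_eq] at h
  unfold Hc at h
  unfold MI
  linarith

variable {𝒳 𝒴 : Type} [Fintype 𝒳] [Fintype 𝒴] {P : 𝒳 → ℝ} {W : 𝒳 → 𝒴 → ℝ}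

lemma isPMF_joint (hP : IsPMF P) (hW : IsKernel W) :
    IsPMF (fun xb : 𝒳 × 𝒴 => P xb.1 * W xb.1 xb.2) :=
  ⟨fun xb => mul_nonneg (hP.1 _) ((hW _).1 _), by
    rw [Fintype.sum_prod_type]
    simp_rw [← Finset.mul_sum, (hW _).2, mul_one]
    exact hP.2⟩

lemma MI_joint (hP : IsPMF P) (hW : IsKernel W) :
    MI (fun xb : 𝒳 × 𝒴 => P xb.1 * W xb.1 xb.2) Prod.fst Prod.snd =
      ∑ xb : 𝒳 × 𝒴, P xb.1 * W xb.1 xb.2 * Real.logb 2 (W xb.1 xb.2 /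
        pr (fun xb : 𝒳 × 𝒴 => P xb.1 * W xb.1 xb.2) Prod.snd xb.2) := by
  classical
  have hj := isPMF_joint hP hW
  have h1 : ∀ x, pr (fun xb : 𝒳 × 𝒴 => P xb.1 * W xb.1 xb.2) Prod.fst x = P x := fun x => by
    unfold pr
    rw [Fintype.sum_prod_type, Finset.sum_eq_single x]
    · simp [← Finset.mul_sum, (hW x).2]
    · intro y _ hy
      simp [hy]
    · simp
  have h2 : ∀ xb, pr (fun xb : 𝒳 × 𝒴 => P xb.1 * W xb.1 xb.2) (fun xb => (xb.1, xb.2)) xb =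
      P xb.1 * W xb.1 xb.2 := fun xb => by
    unfold pr
    simp
  unfold MI
  rw [H_eq, H_eq, H_eq, ← Finset.sum_add_distrib, ← Finset.sum_sub_distrib]
  refine Finset.sum_congr rfl fun xb _ => ?_
  rw [h1, h2]
  rcases (hj.1 xb).lt_or_eq with h | h
  · have hq := h.trans_le (le_pr hj.1 Prod.snd xb)
    beta_reduce at h
    have hP0 : P xb.1 ≠ 0 := fun h0 => by simp [h0] at h
    have hW0 : W xb.1 xb.2 ≠ 0 := fun h0 => by simp [h0] at h
    rw [Real.logb_div hW0 hq.ne', Real.logb_mul hP0 hW0]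
    ring
  · beta_reduce at h
    rw [← h]
    ring

/-- Block covering: a memoryless channel is a mixture of functions of source blocks whose average
entropy rate is close to the mutual information. -/
lemma exists_covering (hP : IsPMF P) (hW : IsKernel W) {ε : ℝ} (hε : 0 < ε) :
    ∃ N₀ : ℕ, ∀ n ≥ N₀, ∃ (κ : Type) (_ : Fintype κ) (w : κ → ℝ)
      (s : κ → (Fin n → 𝒳) → Fin n → 𝒴), IsPMF w ∧
      (∀ x b, pr w (fun k => s k x) b = ∏ i, W (x i) (b i)) ∧
      ∑ k, w k * H (blk n P) (s k) ≤
        n * (MI (fun xb : 𝒳 × 𝒴 => P xb.1 * W xb.1 xb.2) Prod.fst Prod.snd + ε) := by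
  classical
  set j : 𝒳 × 𝒴 → ℝ := fun xb => P xb.1 * W xb.1 xb.2 with hjdef
  have hj : IsPMF j := isPMF_joint hP hW
  set q : 𝒴 → ℝ := pr j Prod.snd with hqdef
  have hq : IsPMF q := ⟨fun b => pr_nonneg hj.1 _ b, by rw [hqdef, sum_pr, hj.2]⟩
  set I := MI j Prod.fst Prod.snd with hI
  have hI0 : 0 ≤ I := MI_nonneg hj _ _
  set l := Real.logb 2 (Fintype.card 𝒴) with hl
  have hl0 : 0 ≤ l := by
    rcases Nat.eq_zero_or_pos (Fintype.card 𝒴) with h | h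
    · simp [hl, h]
    · exact Real.logb_nonneg (by norm_num) (by exact_mod_cast h)
  set f : 𝒳 × 𝒴 → ℝ := fun xb => Real.logb 2 (W xb.1 xb.2 / q xb.2) with hf
  have hfI : ∑ xb, j xb * f xb = I := (MI_joint hP hW).symm
  obtain ⟨θ, hθ, hθl⟩ : ∃ θ : ℝ, 0 < θ ∧ l * (θ + θ + θ) ≤ ε / 4 := by
    refine ⟨ε / (12 * (l + 1)), by positivity, ?_⟩
    have : l * (ε / (12 * (l + 1)) + ε / (12 * (l + 1)) + ε / (12 * (l + 1))) =
        ε / 4 * (l / (l + 1)) := by field_simp; ring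
    rw [this]
    refine mul_le_of_le_one_right (by positivity) ?_
    rw [div_le_one (by positivity)]
    linarith
  obtain ⟨N₁, hN₁⟩ := exists_codebook_size hI0 (δ := ε / 12) (ε := θ * θ) (by positivity)
    (by positivity)
  obtain ⟨N₂, hN₂⟩ := exists_prE_blk_le hj f (δ := ε / 12) (by positivity) hθ
  obtain ⟨N₃, hN₃⟩ := exists_nat_gt (4 / ε)
  refine ⟨max N₁ (max N₂ N₃), fun n hn => ?_⟩
  obtain ⟨K, hK, hK1, hK2⟩ := hN₁ n ((le_max_left _ _).trans hn)
  have hbad := hN₂ n ((le_max_left _ _).trans ((le_max_right _ _).trans hn))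
  have hn3 : (N₃ : ℝ) ≤ n := by
    exact_mod_cast (le_max_right _ _).trans ((le_max_right _ _).trans hn)
  rw [div_lt_iff₀ hε] at hN₃
  have hnε : 4 ≤ n * ε := by nlinarith
  have hWn : IsKernel (fun (x : Fin n → 𝒳) (b : Fin n → 𝒴) => ∏ i, W (x i) (b i)) := fun x =>
    isPMF_prod (p := fun i => W (x i)) fun i => hW (x i)
  obtain ⟨κ, hκ, w, s, hw, hs, hH⟩ := exists_covering_oneshot (isPMF_blk hP n) hWn
    (isPMF_blk hq n) hK (L := 2 ^ (n * (I + ε / 12))) (by positivity) hθ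
  refine ⟨κ, hκ, w, s, hw, hs, hH.trans ?_⟩
  have hK' : (0 : ℝ) < K := by exact_mod_cast hK
  have hcard : Real.logb 2 (Fintype.card (Fin n → 𝒴)) = n * l := by
    rw [Fintype.card_fun, Fintype.card_fin, Nat.cast_pow, Real.logb_pow]
  have hdiv : (2 : ℝ) ^ (n * (I + ε / 12)) / (K * θ) ≤ θ := by
    rw [← div_div, div_le_iff₀ hθ]
    exact hK2
  have hprob : prE (fun xb : (Fin n → 𝒳) × (Fin n → 𝒴) => blk n P xb.1 * ∏ i, W (xb.1 i) (xb.2 i))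
      (fun xb => 2 ^ (n * (I + ε / 12)) * blk n q xb.2 < ∏ i, W (xb.1 i) (xb.2 i)) ≤ θ := by
    rw [← pr_equiv (blk n j) (Equiv.arrowProdEquivProdArrow (Fin n) (fun _ => 𝒳) (fun _ => 𝒴))
      (fun xb => blk n P xb.1 * ∏ i, W (xb.1 i) (xb.2 i))
      (fun ω => by simp [blk, hjdef, Finset.prod_mul_distrib]), prE_pr]
    refine (prE_mono (isPMF_blk hj n).1 fun ω h0 h => ?_).trans hbad
    have hji : ∀ i, 0 < j (ω i) := fun i => (hj.1 _).lt_of_ne' fun hz =>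
      h0.ne' (Finset.prod_eq_zero (Finset.mem_univ i) hz)
    have hqi : ∀ i, 0 < q (ω i).2 := fun i => (hji i).trans_le (le_pr hj.1 Prod.snd _)
    have hWi : ∀ i, 0 < W (ω i).1 (ω i).2 := fun i => ((hW _).1 _).lt_of_ne' fun hz => by
      have := hji i
      simp [hjdef, hz] at this
    simp only [Equiv.arrowProdEquivProdArrow_apply, blk] at h
    rw [hfI]
    have e : ∑ i, f (ω i) = Real.logb 2 ((∏ i, W (ω i).1 (ω i).2) / ∏ i, q (ω i).2) := by
      rw [← Finset.prod_div_distrib, Real.logb_prod _ _ fun i _ => (div_pos (hWi i) (hqi i)).ne']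
    rw [e, Real.lt_logb_iff_rpow_lt (by norm_num)
      (div_pos (Finset.prod_pos fun i _ => hWi i) (Finset.prod_pos fun i _ => hqi i)),
      lt_div_iff₀ (Finset.prod_pos fun i _ => hqi i)]
    exact h
  rw [hcard]
  have h1 : n * l * (prE (fun xb : (Fin n → 𝒳) × (Fin n → 𝒴) =>
      blk n P xb.1 * ∏ i, W (xb.1 i) (xb.2 i))
      (fun xb => 2 ^ (n * (I + ε / 12)) * blk n q xb.2 < ∏ i, W (xb.1 i) (xb.2 i)) + θ +
      2 ^ (n * (I + ε / 12)) / (K * θ)) ≤ n * l * (θ + θ + θ) := by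
    gcongr
  have h2 : n * l * (θ + θ + θ) ≤ n * (ε / 4) := by
    rw [mul_assoc]
    gcongr
  linarith

end BlockCovering

section Averaging

/-- Conditioning reduces entropy. -/
lemma Hc_le_of_fun {Ω α β γ : Type*} [Fintype Ω] [Fintype α] [Fintype β] [Fintype γ] {p : Ω → ℝ}
    (hp : ∀ ω, 0 ≤ p ω) (X : Ω → α) (Y : Ω → β) (f : β → γ) :
    Hc p X Y ≤ Hc p X (fun ω => f (Y ω)) := by
  rw [Hc_eq hp X fun ω => f (Y ω)]
  refine Hc_le_cross hp X Y (fun x y =>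
    pr p (fun ω => (X ω, f (Y ω))) (x, f y) / pr p (fun ω => f (Y ω)) (f y)) (fun x y =>
    div_nonneg (pr_nonneg hp _ _) (pr_nonneg hp _ _)) (fun ω h => div_pos
    (h.trans_le (le_pr hp (fun ω => (X ω, f (Y ω))) ω))
    (h.trans_le (le_pr hp (fun ω => f (Y ω)) ω))) (fun y => ?_)
  rw [← Finset.sum_div, sum_pr_fst]
  exact div_self_le_one _

/-- The single-letter distribution of a source together with two auxiliary random variables
generated by passing `X` through `pU` and `Z` through `pV`. -/
def auxPMF {S 𝒳 𝒵 𝒰 𝒱 : Type*} (p : S → ℝ) (X : S → 𝒳) (Z : S → 𝒵) (pU : 𝒳 → 𝒰 → ℝ)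
    (pV : 𝒵 → 𝒱 → ℝ) : S × 𝒰 × 𝒱 → ℝ :=
  fun x => p x.1 * pU (X x.1) x.2.1 * pV (Z x.1) x.2.2

variable {S 𝒳 𝒵 𝒰 𝒱 : Type} [Fintype S] [Fintype 𝒰] [Fintype 𝒱] {p : S → ℝ} {X : S → 𝒳}
  {Z : S → 𝒵} {pU : 𝒳 → 𝒰 → ℝ}
  {pV : 𝒵 → 𝒱 → ℝ}

lemma pr_auxPMF_fst_left (hV : IsKernel pV) :
    pr (auxPMF p X Z pU pV) (fun x => (X x.1, x.2.1)) =
      fun xu => pr p X xu.1 * pU xu.1 xu.2 := by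
  classical
  funext ⟨x, u⟩
  unfold pr auxPMF
  rw [Fintype.sum_prod_type, Finset.sum_mul]
  refine Finset.sum_congr rfl fun s _ => ?_
  rw [Fintype.sum_prod_type]
  by_cases h : X s = x
  · subst h
    rw [Finset.sum_eq_single u]
    · simp [← Finset.mul_sum, (hV _).2]
    · intro u' _ hu
      simp [hu]
    · simp
  · simp [h]

lemma pr_auxPMF_fst_right (hU : IsKernel pU) :
    pr (auxPMF p X Z pU pV) (fun x => (Z x.1, x.2.2)) =
      fun zv => pr p Z zv.1 * pV zv.1 zv.2 := by
  classical
  funext ⟨z, v⟩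
  unfold pr auxPMF
  rw [Fintype.sum_prod_type, Finset.sum_mul]
  refine Finset.sum_congr rfl fun s _ => ?_
  rw [Fintype.sum_prod_type_right]
  by_cases h : Z s = z
  · subst h
    rw [Finset.sum_eq_single v]
    · simp [← Finset.mul_sum, ← Finset.sum_mul, (hU _).2]
    · intro v' _ hv
      simp [hv]
    · simp
  · simp [h]

lemma pr_auxPMF_fst (hU : IsKernel pU) (hV : IsKernel pV) :
    pr (auxPMF p X Z pU pV) Prod.fst = p := by
  classical
  funext s
  unfold pr auxPMF
  rw [Fintype.sum_prod_type, Finset.sum_eq_single s]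
  · rw [Fintype.sum_prod_type]
    simp [← Finset.mul_sum, (hU _).2, (hV _).2]
  · intro s' _ hs
    simp [hs]
  · simp

lemma isPMF_auxPMF (hp : IsPMF p) (hU : IsKernel pU) (hV : IsKernel pV) :
    IsPMF (auxPMF p X Z pU pV) :=
  ⟨fun x => mul_nonneg (mul_nonneg (hp.1 _) ((hU _).1 _)) ((hV _).1 _), by
    rw [← sum_pr _ Prod.fst, pr_auxPMF_fst hU hV, hp.2]⟩

lemma MI_pr_pair {Ω α β : Type*} [Fintype Ω] [Fintype α] [Fintype β] (p : Ω → ℝ) (X : Ω → α)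
    (Y : Ω → β) : MI (pr p fun ω => (X ω, Y ω)) Prod.fst Prod.snd = MI p X Y := by
  unfold MI
  rw [H_pr, H_pr, H_pr]

/-- Block functions that simulate the auxiliary kernels on average do not, on average, increase
conditional entropies. -/
lemma sum_mul_Hc_blk_le (hp : IsPMF p) (hU : IsKernel pU) (hV : IsKernel pV) {n : ℕ}
    {κ μ : Type*} [Fintype κ] [Fintype μ] {w : κ → ℝ} {ν : μ → ℝ} (hw : IsPMF w) (hν : IsPMF ν)
    {t : κ → (Fin n → 𝒳) → Fin n → 𝒰} {s : μ → (Fin n → 𝒵) → Fin n → 𝒱}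
    (ht : ∀ x u, pr w (fun k => t k x) u = ∏ i, pU (x i) (u i))
    (hs : ∀ z v, pr ν (fun j => s j z) v = ∏ i, pV (z i) (v i))
    {α β : Type*} [Fintype α] [Fintype β] (F : S × 𝒰 × 𝒱 → α) (G : S × 𝒰 × 𝒱 → β) :
    ∑ kj : κ × μ, w kj.1 * ν kj.2 * Hc (blk n p)
      (fun ω i => F (ω i, t kj.1 (fun i => X (ω i)) i, s kj.2 (fun i => Z (ω i)) i))
      (fun ω i => G (ω i, t kj.1 (fun i => X (ω i)) i, s kj.2 (fun i => Z (ω i)) i)) ≤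
    n * Hc (auxPMF p X Z pU pV) F G := by
  classical
  set Q : (Fin n → S) × (Fin n → 𝒰) × (Fin n → 𝒱) → ℝ := fun x =>
    blk n p x.1 * (∏ i, pU (X (x.1 i)) (x.2.1 i)) * ∏ i, pV (Z (x.1 i)) (x.2.2 i) with hQ
  set P : κ × μ → (Fin n → S) × (Fin n → 𝒰) × (Fin n → 𝒱) → ℝ := fun kj =>
    pr (blk n p) fun ω => (ω, t kj.1 (fun i => X (ω i)), s kj.2 (fun i => Z (ω i))) with hP
  have hPv : ∀ k j ω u v, P (k, j) (ω, u, v) = blk n p ω *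
      (if t k (fun i => X (ω i)) = u then 1 else 0) *
      (if s j (fun i => Z (ω i)) = v then 1 else 0) := fun k j ω u v => by
    simp only [hP]
    unfold pr
    rw [Finset.sum_eq_single ω]
    · by_cases h1 : t k (fun i => X (ω i)) = u <;> by_cases h2 : s j (fun i => Z (ω i)) = v <;>
        simp [h1, h2]
    · intro ω' _ h
      simp [h]
    · simp
  have hmix : ∀ x, Q x = ∑ kj : κ × μ, w kj.1 * ν kj.2 * P kj x := by
    rintro ⟨ω, u, v⟩
    have e1 : ∏ i, pU (X (ω i)) (u i) =
        ∑ k, w k * if t k (fun i => X (ω i)) = u then 1 else 0 := by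
      rw [← ht (fun i => X (ω i)) u]
      unfold pr
      exact Finset.sum_congr rfl fun k _ => by split_ifs <;> simp
    have e2 : ∏ i, pV (Z (ω i)) (v i) =
        ∑ j, ν j * if s j (fun i => Z (ω i)) = v then 1 else 0 := by
      rw [← hs (fun i => Z (ω i)) v]
      unfold pr
      exact Finset.sum_congr rfl fun k _ => by split_ifs <;> simp
    simp only [hQ]
    rw [e1, e2, mul_assoc, Finset.sum_mul_sum, ← Fintype.sum_prod_type', Finset.mul_sum]
    refine Finset.sum_congr rfl fun kj _ => ?_
    rw [← Prod.mk.eta (p := kj), hPv]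
    ring
  have h := sum_mul_Hc_le (w := fun kj : κ × μ => w kj.1 * ν kj.2)
    (fun kj => mul_nonneg (hw.1 _) (hν.1 _)) (P := P)
    (fun kj x => pr_nonneg (isPMF_blk hp n).1 _ _) hmix
    (fun x i => F (x.1 i, x.2.1 i, x.2.2 i)) (fun x i => G (x.1 i, x.2.1 i, x.2.2 i))
  simp only [hP, Hc_pr] at h
  refine h.trans (le_of_eq ?_)
  rw [← Hc_blk (isPMF_auxPMF hp hU hV), ← pr_equiv (blk n (auxPMF p X Z pU pV))
    ((Equiv.arrowProdEquivProdArrow (Fin n) (fun _ => S) (fun _ => 𝒰 × 𝒱)).trans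
      (Equiv.prodCongr (Equiv.refl _)
        (Equiv.arrowProdEquivProdArrow (Fin n) (fun _ => 𝒰) (fun _ => 𝒱)))) Q
    (fun ω => by simp [hQ, blk, auxPMF, Finset.prod_mul_distrib]), Hc_pr]
  rfl

end Averaging

section SingleLetter

variable {S 𝒳 𝒵 ℰ 𝒰 𝒱 : Type} [Fintype S] [Fintype 𝒳] [Fintype 𝒵] [Fintype ℰ] [Fintype 𝒰]
  [Fintype 𝒱] {p : S → ℝ} {X : S → 𝒳} {Z : S → 𝒵} {E : S → ℰ} {pU : 𝒳 → 𝒰 → ℝ}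
  {pV : 𝒵 → 𝒱 → ℝ}

lemma exists_covering_source (hp : IsPMF p) (Y : S → 𝒳) {W : 𝒳 → 𝒰 → ℝ} (hW : IsKernel W)
    {ε : ℝ} (hε : 0 < ε) :
    ∃ N₀ : ℕ, ∀ n ≥ N₀, ∃ (κ : Type) (_ : Fintype κ) (w : κ → ℝ)
      (s : κ → (Fin n → 𝒳) → Fin n → 𝒰), IsPMF w ∧
      (∀ x b, pr w (fun k => s k x) b = ∏ i, W (x i) (b i)) ∧
      ∑ k, w k * H (blk n p) (fun ω => s k fun i => Y (ω i)) ≤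
        n * (MI (fun xb : 𝒳 × 𝒰 => pr p Y xb.1 * W xb.1 xb.2) Prod.fst Prod.snd + ε) := by
  obtain ⟨N₀, h⟩ := exists_covering (P := pr p Y)
    ⟨fun x => pr_nonneg hp.1 Y x, by rw [sum_pr, hp.2]⟩ hW hε
  refine ⟨N₀, fun n hn => ?_⟩
  obtain ⟨κ, hκ, w, s, hw, hs, hH⟩ := h n hn
  refine ⟨κ, hκ, w, s, hw, hs, le_trans (le_of_eq ?_) hH⟩
  have e : blk n (pr p Y) = pr (blk n p) fun ω i => Y (ω i) := by
    funext x
    rw [pr_blk]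
    rfl
  simp_rw [e, H_pr]

/-- Achievability for auxiliary random variables generated by single-letter kernels. -/
lemma eventuallyAchievable_auxPMF (hp : IsPMF p) (X : S → 𝒳) (Z : S → 𝒵) (E : S → ℰ)
    (hU : IsKernel pU) (hV : IsKernel pV) :
    EventuallyAchievable p X Z E
      (Hc (auxPMF p X Z pU pV) (fun x => X x.1) (fun x => x.2.2),
        MI (auxPMF p X Z pU pV) (fun x => Z x.1) (fun x => x.2.2) +
          Hc (auxPMF p X Z pU pV) (fun x => Z x.1) (fun x => (X x.1, x.2.2)),
        cMI (auxPMF p X Z pU pV) (fun x => X x.1) (fun x => x.2.2) (fun x => x.2.1) -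
          cMI (auxPMF p X Z pU pV) (fun x => X x.1) (fun x => E x.1) (fun x => x.2.1)) := by
  set q := auxPMF p X Z pU pV with hqdef
  have hq : IsPMF q := isPMF_auxPMF hp hU hV
  have hS : Nonempty S := by
    by_contra h
    rw [not_nonempty_iff] at h
    simpa using hp.2
  have h𝒳 : Nonempty 𝒳 := hS.map X
  have h𝒵 : Nonempty 𝒵 := hS.map Z
  refine EventuallyAchievable.of_approx fun ε hε => ?_
  obtain ⟨N₁, hN₁⟩ := exists_covering_source hp X hU hε
  obtain ⟨N₂, hN₂⟩ := exists_covering_source hp Z hV hε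
  obtain ⟨n, hn0, hn1, hn2⟩ : ∃ n, 0 < n ∧ N₁ ≤ n ∧ N₂ ≤ n := ⟨N₁ + N₂ + 1, by omega, by omega,
    by omega⟩
  have hn' : (0 : ℝ) < n := by exact_mod_cast hn0
  obtain ⟨κ, hκ, w, t, hw, ht, hHt⟩ := hN₁ n hn1
  obtain ⟨μ, hμ, ν, s, hν, hs, hHs⟩ := hN₂ n hn2
  rw [← pr_auxPMF_fst_left (Z := Z) (pU := pU) hV, MI_pr_pair, ← hqdef] at hHt
  rw [← pr_auxPMF_fst_right (X := X) (pV := pV) hU, MI_pr_pair, ← hqdef] at hHs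
  have avg := fun {α β : Type} [Fintype α] [Fintype β] (F : S × 𝒰 × 𝒱 → α)
    (G : S × 𝒰 × 𝒱 → β) => sum_mul_Hc_blk_le (X := X) (Z := Z) hp hU hV hw hν ht hs F G
  set W : κ × μ → ℝ := fun kj => w kj.1 * ν kj.2 with hWdef
  have hW0 : ∀ kj, 0 ≤ W kj := fun kj => mul_nonneg (hw.1 _) (hν.1 _)
  have hW1 : ∑ kj, W kj = 1 := by
    rw [Fintype.sum_prod_type]
    simp only [hWdef]
    simp_rw [← Finset.mul_sum, hν.2, mul_one]
    exact hw.2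
  have hWt : ∀ f : κ → ℝ, ∑ kj, W kj * f kj.1 = ∑ k, w k * f k := fun f => by
    rw [Fintype.sum_prod_type]
    simp only [hWdef]
    refine Finset.sum_congr rfl fun k _ => ?_
    rw [← Finset.sum_mul, ← Finset.mul_sum, hν.2, mul_one]
  have hWs : ∀ f : μ → ℝ, ∑ kj, W kj * f kj.2 = ∑ j, ν j * f j := fun f => by
    rw [Fintype.sum_prod_type_right]
    simp only [hWdef]
    refine Finset.sum_congr rfl fun k _ => ?_
    rw [← Finset.sum_mul, ← Finset.sum_mul, hw.2, one_mul]
  have key := convex_eventuallyAchievable hp (X := X) (Z := Z) (E := E) |>.sum_mem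
    (fun kj _ => hW0 kj) hW1
    (fun kj _ => eventuallyAchievable_of_blocks hp hn0 (t kj.1) (s kj.2))
  have hA : ∑ kj, W kj * Hc (blk n p) (fun ω i => X (ω i))
      (fun ω => s kj.2 fun i => Z (ω i)) ≤ n * Hc q (fun x => X x.1) (fun x => x.2.2) :=
    avg (fun x => X x.1) (fun x => x.2.2)
  have hC : ∑ kj, W kj * Hc (blk n p) (fun ω i => Z (ω i))
      (fun ω => (fun i => X (ω i), s kj.2 fun i => Z (ω i))) ≤
      n * Hc q (fun x => Z x.1) (fun x => (X x.1, x.2.2)) := by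
    refine le_trans (le_of_eq ?_) (avg (fun x => Z x.1) (fun x => (X x.1, x.2.2)))
    refine Finset.sum_congr rfl fun kj _ => congrArg (W kj * ·) ?_
    refine Hc_congr_iff _ (fun ω ω' => ?_) (fun ω ω' => ?_) <;>
    simp only [Prod.ext_iff, funext_iff, forall_and]
  have hU' : ∑ kj, W kj * Hc (blk n p) (fun ω i => E (ω i))
      (fun ω => t kj.1 fun i => X (ω i)) ≤ n * Hc q (fun x => E x.1) (fun x => x.2.1) :=
    avg (fun x => E x.1) (fun x => x.2.1)
  have hUV : ∑ kj, W kj * Hc (blk n p) (fun ω i => X (ω i))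
      (fun ω => (t kj.1 fun i => X (ω i), s kj.2 fun i => Z (ω i))) ≤
      n * Hc q (fun x => X x.1) (fun x => (x.2.1, x.2.2)) := by
    refine le_trans (le_of_eq ?_) (avg (fun x => X x.1) (fun x => (x.2.1, x.2.2)))
    refine Finset.sum_congr rfl fun kj _ => congrArg (W kj * ·) ?_
    refine Hc_congr_iff _ (fun ω ω' => ?_) (fun ω ω' => ?_) <;>
    simp only [Prod.ext_iff, funext_iff, forall_and]
  have hXE : H (blk n p) (fun ω => (fun i => X (ω i), fun i => E (ω i))) =
      n * H q (fun x => (X x.1, E x.1)) := by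
    rw [H_blk_pair hp, ← H_pr q Prod.fst fun s => (X s, E s), hqdef, pr_auxPMF_fst hU hV]
  have hTE : ∀ kj : κ × μ, H (blk n p) (fun ω => (t kj.1 fun i => X (ω i), fun i => E (ω i))) =
      H (blk n p) (fun ω => t kj.1 fun i => X (ω i)) +
        Hc (blk n p) (fun ω i => E (ω i)) (fun ω => t kj.1 fun i => X (ω i)) := fun kj => by
    unfold Hc
    rw [add_sub_cancel]
    refine H_congr_iff _ fun ω ω' => ?_
    simp only [Prod.ext_iff]
    exact and_comm
  have hcond : Hc q (fun x => x.2.1) (fun x => (X x.1, E x.1)) ≤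
      Hc q (fun x => x.2.1) (fun x => X x.1) :=
    Hc_le_of_fun hq.1 (fun x => x.2.1) (fun x => (X x.1, E x.1)) Prod.fst
  refine ⟨_, key, ?_, ?_, ?_⟩
  · simp only [Prod.fst_sum, Prod.smul_fst, smul_eq_mul]
    simp_rw [← mul_div_assoc]
    rw [← Finset.sum_div, div_le_iff₀ hn']
    nlinarith
  · simp only [Prod.snd_sum, Prod.fst_sum, Prod.smul_snd, Prod.smul_fst, smul_eq_mul]
    simp_rw [← mul_div_assoc]
    rw [← Finset.sum_div, div_le_iff₀ hn']
    simp_rw [mul_add]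
    rw [Finset.sum_add_distrib, hWs fun j => H (blk n p) fun ω => s j fun i => Z (ω i)]
    linarith
  · simp only [Prod.snd_sum, Prod.smul_snd, smul_eq_mul]
    simp_rw [← mul_div_assoc]
    rw [← Finset.sum_div, le_div_iff₀ hn']
    simp_rw [mul_sub, hTE, mul_add]
    rw [Finset.sum_sub_distrib, Finset.sum_sub_distrib, Finset.sum_add_distrib,
      hWt fun k => H (blk n p) fun ω => t k fun i => X (ω i), ← Finset.sum_mul, hW1, one_mul, hXE]
    have e1 : H q (fun x => (x.2.1, X x.1)) = H q (fun x => (X x.1, x.2.1)) :=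
      H_congr_iff q fun x x' => by simp only [Prod.ext_iff]; exact and_comm
    have e2 : H q (fun x => (x.2.1, X x.1, E x.1)) = H q (fun x => (X x.1, E x.1, x.2.1)) :=
      H_congr_iff q fun x x' => by simp only [Prod.ext_iff]; tauto
    have e3 : Hc q (fun x => X x.1) (fun x => (x.2.1, x.2.2)) =
        Hc q (fun x => X x.1) (fun x => (x.2.2, x.2.1)) :=
      Hc_congr_iff q (fun x x' => by simp only [Prod.ext_iff]; tauto)
        (fun x x' => by simp only [Prod.ext_iff]; exact and_comm)
    have hle : cMI q (fun x => X x.1) (fun x => x.2.2) (fun x => x.2.1) -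
        cMI q (fun x => X x.1) (fun x => E x.1) (fun x => x.2.1) ≤
        H q (fun x => (X x.1, E x.1)) - MI q (fun x => X x.1) (fun x => x.2.1) -
        Hc q (fun x => E x.1) (fun x => x.2.1) -
        Hc q (fun x => X x.1) (fun x => (x.2.1, x.2.2)) := by
      rw [e3]
      unfold cMI MI
      unfold Hc at hcond ⊢
      linarith
    have := mul_le_mul_of_nonneg_left hle hn'.le
    linarith

end SingleLetter

section InnerBound

variable {𝒜 𝒞 ℰ : Type} [Fintype 𝒜] [Fintype 𝒞] [Fintype ℰ] {p : 𝒜 × 𝒞 × ℰ → ℝ}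

lemma eventuallyAchievable_of_mem_RinBase (hp : IsPMF p) {r : ℝ × ℝ × ℝ} (hr : r ∈ RinBase p) :
    EventuallyAchievable p (fun x => x.1) (fun x => x.2.1) (fun x => x.2.2) r := by
  obtain ⟨nU, nV, pU, pV, q, hU, hV, hq, h0, hC, hA, hΔ, -, -⟩ := hr
  have e : pr (auxPMF p (fun x => x.1) (fun x => x.2.1) pU pV)
      (fun x => (x.1.1, x.1.2.1, x.1.2.2, x.2.1, x.2.2)) = q :=
    pr_equiv _
      { toFun := fun x => (x.1.1, x.1.2.1, x.1.2.2, x.2.1, x.2.2)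
        invFun := fun x => ((x.1, x.2.1, x.2.2.1), x.2.2.2.1, x.2.2.2.2)
        left_inv := fun _ => rfl
        right_inv := fun _ => rfl } q fun x => hq _
  have h := eventuallyAchievable_auxPMF hp (fun x => x.1) (fun x => x.2.1) (fun x => x.2.2) hU hV
  subst e
  simp only [cMI, MI, Hc_pr, H_pr] at h0 hC hA hΔ h
  rw [h0, add_zero] at h
  exact EventuallyAchievable.of_approx fun ε hε =>
    ⟨_, h.max_zero hp, by linarith, by linarith, by linarith⟩

lemma EventuallyAchievable.achievable {r : ℝ × ℝ × ℝ}
    (h : EventuallyAchievable p (fun x => x.1) (fun x => x.2.1) (fun x => x.2.2) r) :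
    Achievable p r.1 r.2.1 r.2.2 := by
  intro ε hε
  obtain ⟨N₀, hN₀⟩ := h (ε / 2) (half_pos hε)
  obtain ⟨MA, MC, hMA, hMC, fA, fC, g, h1, h2, h3, h4⟩ := (hN₀ (N₀ + 1) (Nat.le_succ _)).mono
    (a' := (N₀ + 1 : ℕ) * (r.1 + ε)) (c' := (N₀ + 1 : ℕ) * (r.2.1 + ε))
    (d' := (N₀ + 1 : ℕ) * (r.2.2 - ε)) (by gcongr; linarith) (by gcongr; linarith)
    (by gcongr; linarith) le_rfl
  exact ⟨N₀ + 1, MA, MC, Nat.succ_pos _, hMA, hMC, fA, fC, g, h1, h2, h3,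
    h4.trans_lt (half_lt_self hε)⟩

end InnerBound

end SSW


/-- Inner bound of Theorem 1: every triple in `ℛ_in = convexHull(RinBase p)` is achievable,
i.e. `ℛ_in ⊆ ℛ`. -/
theorem inner_bound {𝒜 𝒞 ℰ : Type} [Fintype 𝒜] [Fintype 𝒞] [Fintype ℰ]
    (p : 𝒜 × 𝒞 × ℰ → ℝ) (hp : IsPMF p) :
    convexHull ℝ (RinBase p) ⊆ { r : ℝ × ℝ × ℝ | Achievable p r.1 r.2.1 r.2.2 } :=
  (convexHull_min (fun _ => eventuallyAchievable_of_mem_RinBase hp)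
    (convex_eventuallyAchievable hp)).trans fun _ => EventuallyAchievable.achievable
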